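/- arXiv:1508.02962 — 2 statements merged into one kernel-verified Lean document; each statement's English description precedes it below -/
import Mathlib

section
/- Let F be a cone subequation on ℝⁿ satisfying condition (F3), let Ω ⊂ ℝⁿ be a bounded domain with smooth strictly F-convex boundary, let φ ∈ C(∂Ω), and let x₁,…,x_k ∈ Ω. Suppose for each j that h_j ∈ C(Ω̄) is F-harmonic on Ω ∖ {x_j} with a downward-pointing singularity of finite type at x_j, and that x_j is a strict global minimum point of h_j on Ω̄. Suppose further there exists h ∈ C(Ω̄) that is F-subharmonic on Ω ∖ {x₁,…,x_k}, satisfies h ∼ h_j at each x_j, and satisfies h ≤ φ on ∂Ω. Then there exists H ∈ C(Ω̄) such that: (1) H is F-harmonic on Ω ∖ {x₁,…,x_k}; (2) H = φ on ∂Ω and H(x_j) = h(x_j) for each j; and (3) there exists a constant c > 1 such that for every ε > 0 and every j, 1 − ε ≤ (H(x) − h(x_j))/(h_j(x) − h_j(x_j)) ≤ c for all x sufficiently near x_j. -/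
open scoped Topology Classical
open Filter

noncomputable section

/-- Euclidean space ℝⁿ. -/
abbrev EucSp (n : ℕ) := EuclideanSpace ℝ (Fin n)

/-- The space Sym²(ℝⁿ) of symmetric real n×n matrices, with its subspace topology. -/
abbrev SymMat (n : ℕ) := selfAdjoint (Matrix (Fin n) (Fin n) ℝ)

variable {n : ℕ}

/-- The matrix of the orthogonal projection onto the line ℝ·e (for a unit vector e). -/
def projMat (e : EucSp n) : Matrix (Fin n) (Fin n) ℝ := Matrix.of fun i j => e i * e j

lemma projMat_selfAdjoint (e : EucSp n) :
    projMat e ∈ selfAdjoint (Matrix (Fin n) (Fin n) ℝ) := by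
  rw [selfAdjoint.mem_iff]
  ext i j
  simp [projMat, Matrix.star_apply, mul_comm]

/-- P_e, the projection onto ℝ·e, as an element of Sym²(ℝⁿ). -/
def symProj (e : EucSp n) : SymMat n := ⟨projMat e, projMat_selfAdjoint e⟩

/-- The matrix P_{e⊥} − (p−1)·P_e. -/
def charMatM (p : ℝ) (e : EucSp n) : Matrix (Fin n) (Fin n) ℝ :=
  (1 - projMat e) - (p - 1) • projMat e

lemma charMatM_selfAdjoint (p : ℝ) (e : EucSp n) :
    charMatM p e ∈ selfAdjoint (Matrix (Fin n) (Fin n) ℝ) := by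
  have h := projMat_selfAdjoint e
  rw [selfAdjoint.mem_iff] at h ⊢
  simp [charMatM, star_sub, star_smul, star_one, h]

/-- P_{e⊥} − (p−1)·P_e as an element of Sym²(ℝⁿ). -/
def charMat (p : ℝ) (e : EucSp n) : SymMat n := ⟨charMatM p e, charMatM_selfAdjoint p e⟩

/-- A (constant coefficient, pure second order) cone subequation on ℝⁿ: a nonempty,
closed, proper subset of Sym²(ℝⁿ) satisfying positivity (F1) and the cone property (F2). -/
structure ConeSubequation (n : ℕ) where
  carrier : Set (SymMat n)
  nonempty' : carrier.Nonempty
  proper' : carrier ≠ Set.univ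
  isClosed' : IsClosed carrier
  f1 : ∀ A ∈ carrier, ∀ P : SymMat n, (P : Matrix (Fin n) (Fin n) ℝ).PosSemidef → A + P ∈ carrier
  f2 : ∀ A ∈ carrier, ∀ t : ℝ, 0 < t → t • A ∈ carrier

/-- The dual of a set of symmetric matrices: F̃ = {A : −A ∉ Int F}. -/
def dualSet (S : Set (SymMat n)) : Set (SymMat n) := {A | -A ∉ interior S}

/-- The subequation P = {A ≥ 0} of positive semidefinite matrices. -/
def PosP (n : ℕ) : Set (SymMat n) := {A | (A : Matrix (Fin n) (Fin n) ℝ).PosSemidef}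

/-- The Hessian matrix (D²f)(x) of a real function on ℝⁿ. -/
def hessMatrix (f : EucSp n → ℝ) (x : EucSp n) : Matrix (Fin n) (Fin n) ℝ :=
  Matrix.of fun i j =>
    iteratedFDeriv ℝ 2 f x ![EuclideanSpace.single i 1, EuclideanSpace.single j 1]

/-- ψ is a test function for u at x₀ (relative to the set X): ψ is C² near x₀,
u ≤ ψ near x₀ (within X), and u(x₀) = ψ(x₀). -/
def IsTestAt (X : Set (EucSp n)) (u : EucSp n → EReal) (ψ : EucSp n → ℝ) (x₀ : EucSp n) :
    Prop :=
  ContDiffAt ℝ 2 ψ x₀ ∧ (∀ᶠ x in 𝓝[X] x₀, u x ≤ (ψ x : EReal)) ∧ u x₀ = (ψ x₀ : EReal)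

/-- u admits no test functions at x₀ (relative to X). -/
def NoTestAt (X : Set (EucSp n)) (u : EucSp n → EReal) (x₀ : EucSp n) : Prop :=
  ∀ ψ : EucSp n → ℝ, ¬ IsTestAt X u ψ x₀

/-- u is S-subharmonic on X (viscosity sense): u is upper semicontinuous on X with values
in [−∞,∞), and for every test function ψ for u at a point of X, the Hessian of ψ there
lies in S. -/
def FSubharmonicOn (S : Set (SymMat n)) (X : Set (EucSp n)) (u : EucSp n → EReal) : Prop :=
  UpperSemicontinuousOn u X ∧ (∀ x ∈ X, u x ≠ ⊤) ∧
    ∀ x₀ ∈ X, ∀ ψ : EucSp n → ℝ, IsTestAt X u ψ x₀ →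
      hessMatrix ψ x₀ ∈ Subtype.val '' S

/-- u is F-harmonic on X: u is F-subharmonic and −u is F̃-subharmonic on X. -/
def FHarmonicOn (F : ConeSubequation n) (X : Set (EucSp n)) (u : EucSp n → EReal) : Prop :=
  FSubharmonicOn F.carrier X u ∧ FSubharmonicOn (dualSet F.carrier) X (fun x => -u x)

/-- u is subaffine on X, i.e. P̃-subharmonic on X. -/
def SubaffineOn (X : Set (EucSp n)) (u : EucSp n → EReal) : Prop :=
  FSubharmonicOn (dualSet (PosP n)) X u

/-- h is a downward-pointing singular F-harmonic at x₀ on the neighborhood U: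
continuous, F-subharmonic on U, F-harmonic on U∖{x₀}, with a strict minimum at x₀, and
either of polar type (h(x₀) = −∞) or of finite type (h(x₀) > −∞, no test functions at x₀). -/
structure DPSingular (F : ConeSubequation n) (U : Set (EucSp n)) (x₀ : EucSp n)
    (h : EucSp n → EReal) : Prop where
  isOpen' : IsOpen U
  mem : x₀ ∈ U
  cont : ContinuousOn h U
  subh : FSubharmonicOn F.carrier U h
  harm : FHarmonicOn F (U \ {x₀}) h
  strictMin : ∀ x ∈ U, x ≠ x₀ → h x₀ < h x
  polarOrFinite : h x₀ = ⊥ ∨ (h x₀ ≠ ⊥ ∧ NoTestAt U h x₀)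

/-- Polar-case asymptotic equivalence H ≈ h at x₀: h − C ≤ H ≤ h + C near x₀. -/
def PolarAsymp (H : EucSp n → ℝ) (h : EucSp n → EReal) (x₀ : EucSp n) : Prop :=
  ∃ C : ℝ, ∀ᶠ x in 𝓝[≠] x₀, h x - (C : EReal) ≤ (H x : EReal) ∧ (H x : EReal) ≤ h x + (C : EReal)

/-- Finite-case asymptotic equivalence H ∼ h at x₀:
lim_{x→x₀} (H(x) − H(x₀))/(h(x) − h(x₀)) = 1. -/
def FiniteAsymp (H : EucSp n → ℝ) (h : EucSp n → EReal) (x₀ : EucSp n) : Prop :=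
  Tendsto (fun x => (H x - H x₀) / ((h x).toReal - (h x₀).toReal)) (𝓝[≠] x₀) (𝓝 1)

/-- Ω is a bounded domain: open, connected and bounded. -/
def IsBoundedDomain (Ω : Set (EucSp n)) : Prop :=
  IsOpen Ω ∧ IsConnected Ω ∧ Bornology.IsBounded Ω

/-- Condition (F3): −P_e ∉ F for every unit vector e. -/
def CondF3 (F : ConeSubequation n) : Prop :=
  ∀ e : EucSp n, ‖e‖ = 1 → -(symProj e) ∉ F.carrier

/-- The inward unit normal −∇ρ(x)/|∇ρ(x)| of the hypersurface {ρ = 0} bounding {ρ < 0}. -/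
def innerNormal (ρ : EucSp n → ℝ) (x : EucSp n) : EucSp n :=
  -(‖gradient ρ x‖⁻¹ • gradient ρ x)

/-- The second fundamental form of {ρ = 0} at x with respect to the inward normal,
extended by zero on the normal line: the tangential part of Hess ρ(x)/|∇ρ(x)|. -/
def secondFF (ρ : EucSp n → ℝ) (x : EucSp n) : Matrix (Fin n) (Fin n) ℝ :=
  ‖gradient ρ x‖⁻¹ •
    ((1 - projMat (innerNormal ρ x)) * hessMatrix ρ x * (1 - projMat (innerNormal ρ x)))

/-- Ω has smooth boundary which is strictly F-convex: Ω is globally defined by a smooth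
defining function ρ with nonvanishing gradient along ∂Ω, and at every boundary point
II_x + t·P_{ν(x)} ∈ Int F for all sufficiently large t. -/
def StrictlyConvexBoundary (F : ConeSubequation n) (Ω : Set (EucSp n)) : Prop :=
  ∃ ρ : EucSp n → ℝ, ContDiff ℝ (⊤ : ℕ∞) ρ ∧ Ω = {x | ρ x < 0} ∧
    ∀ x ∈ frontier Ω, gradient ρ x ≠ 0 ∧
      ∃ t₀ : ℝ, ∀ t ≥ t₀,
        secondFF ρ x + t • projMat (innerNormal ρ x) ∈ Subtype.val '' interior F.carrier

/-- F is invariant under O(n): gᵀ A g ∈ F for every orthogonal g and A ∈ F. -/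
def OrthInvariant (F : ConeSubequation n) : Prop :=
  ∀ g : Matrix (Fin n) (Fin n) ℝ, g.transpose * g = 1 →
    ∀ A ∈ F.carrier, ∀ B : SymMat n,
      (B : Matrix (Fin n) (Fin n) ℝ) = g.transpose * (A : Matrix (Fin n) (Fin n) ℝ) * g →
      B ∈ F.carrier

/-- F has Riesz characteristic p: P_{e⊥} − (p−1)P_e ∈ ∂F for every unit vector e. -/
def HasRieszChar (F : ConeSubequation n) (p : ℝ) : Prop :=
  ∀ e : EucSp n, ‖e‖ = 1 → charMat p e ∈ frontier F.carrier

/-- The Riesz kernel K_p. -/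
def rieszKernel (p : ℝ) (x : EucSp n) : ℝ :=
  if p = 2 then Real.log ‖x‖ else -(p - 2)⁻¹ * ‖x‖ ^ (2 - p)

namespace ConeSubequation

/-- The matrices underlying the elements of a cone subequation. -/
def mats (F : ConeSubequation n) : Set (Matrix (Fin n) (Fin n) ℝ) :=
  Subtype.val '' F.carrier

/-- The matrices underlying the interior of a cone subequation. -/
def intMats (F : ConeSubequation n) : Set (Matrix (Fin n) (Fin n) ℝ) :=
  Subtype.val '' interior F.carrier

lemma isClosed_mats (F : ConeSubequation n) : IsClosed F.mats := by
  have hcl : IsClosed {A : Matrix (Fin n) (Fin n) ℝ | star A = A} :=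
    isClosed_eq continuous_star continuous_id
  have hemb : IsClosed (selfAdjoint (Matrix (Fin n) (Fin n) ℝ) :
      Set (Matrix (Fin n) (Fin n) ℝ)) := hcl
  exact hemb.isClosedEmbedding_subtypeVal.isClosedMap _ F.isClosed'

lemma intMats_subset (F : ConeSubequation n) : F.intMats ⊆ F.mats :=
  Set.image_mono interior_subset

lemma mats_add (F : ConeSubequation n) {A P : Matrix (Fin n) (Fin n) ℝ}
    (hA : A ∈ F.mats) (hP : P.PosSemidef) : A + P ∈ F.mats := by
  obtain ⟨B, hB, rfl⟩ := hA
  exact ⟨B + ⟨P, hP.isHermitian⟩, F.f1 B hB ⟨P, hP.isHermitian⟩ hP, rfl⟩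

lemma mats_smul (F : ConeSubequation n) {A : Matrix (Fin n) (Fin n) ℝ}
    (hA : A ∈ F.mats) {t : ℝ} (ht : 0 < t) : t • A ∈ F.mats := by
  obtain ⟨B, hB, rfl⟩ := hA
  exact ⟨t • B, F.f2 B hB t ht, rfl⟩

lemma interior_add (F : ConeSubequation n) {A P : SymMat n} (hA : A ∈ interior F.carrier)
    (hP : (P : Matrix (Fin n) (Fin n) ℝ).PosSemidef) : A + P ∈ interior F.carrier := by
  have hopen : IsOpen ((fun B : SymMat n => B - P) ⁻¹' interior F.carrier) :=
    isOpen_interior.preimage (continuous_id.sub continuous_const)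
  refine interior_maximal ?_ hopen (by simpa using hA)
  intro B hB
  simpa using F.f1 _ (interior_subset hB) P hP

lemma interior_smul (F : ConeSubequation n) {A : SymMat n} (hA : A ∈ interior F.carrier)
    {t : ℝ} (ht : 0 < t) : t • A ∈ interior F.carrier := by
  have hopen : IsOpen ((fun B : SymMat n => t⁻¹ • B) ⁻¹' interior F.carrier) :=
    isOpen_interior.preimage
      ((continuous_subtype_val.const_smul t⁻¹).subtype_mk fun B => (t⁻¹ • B).2)
  refine interior_maximal ?_ hopen (by simpa [smul_smul, ht.ne'] using hA)
  intro B hB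
  simpa [smul_smul, ht.ne'] using F.f2 _ (interior_subset hB) t ht

lemma intMats_add (F : ConeSubequation n) {A P : Matrix (Fin n) (Fin n) ℝ}
    (hA : A ∈ F.intMats) (hP : P.PosSemidef) : A + P ∈ F.intMats := by
  obtain ⟨B, hB, rfl⟩ := hA
  exact ⟨B + ⟨P, hP.isHermitian⟩, F.interior_add (P := ⟨P, hP.isHermitian⟩) hB hP, rfl⟩

lemma intMats_smul (F : ConeSubequation n) {A : Matrix (Fin n) (Fin n) ℝ}
    (hA : A ∈ F.intMats) {t : ℝ} (ht : 0 < t) : t • A ∈ F.intMats := by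
  obtain ⟨B, hB, rfl⟩ := hA
  exact ⟨t • B, F.interior_smul hB ht, rfl⟩

lemma eventually_mem_intMats (F : ConeSubequation n) {X : Type*} {l : Filter X}
    {f : X → Matrix (Fin n) (Fin n) ℝ} {A : Matrix (Fin n) (Fin n) ℝ}
    (hf : Tendsto f l (𝓝 A)) (hs : ∀ᶠ y in l, (f y).IsSymm) (hA : A ∈ F.intMats) :
    ∀ᶠ y in l, f y ∈ F.intMats := by
  obtain ⟨B, hB, rfl⟩ := hA
  obtain ⟨V, hV, hVF⟩ := isOpen_induced_iff.1 (isOpen_interior (s := F.carrier))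
  have hBV : (B : Matrix (Fin n) (Fin n) ℝ) ∈ V := by
    rw [← hVF] at hB; exact hB
  filter_upwards [hf.eventually (hV.mem_nhds hBV), hs] with y hy hsy
  refine ⟨⟨f y, ?_⟩, ?_, rfl⟩
  · rw [selfAdjoint.mem_iff]; exact hsy
  · rw [← hVF]; exact hy

lemma zero_notMem_interior (F : ConeSubequation n) : (0 : SymMat n) ∉ interior F.carrier := by
  intro h0
  refine F.proper' (Set.eq_univ_of_forall fun A => ?_)
  have ht : Tendsto (fun t : ℝ => t • A) (𝓝[>] 0) (𝓝 0) := by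
    have : Tendsto (fun t : ℝ => t • A) (𝓝 0) (𝓝 ((0 : ℝ) • A)) :=
      ((continuous_id.smul continuous_const).subtype_mk fun t : ℝ => (t • A).2).tendsto 0
    rw [zero_smul] at this
    exact this.mono_left nhdsWithin_le_nhds
  obtain ⟨t, ht, htpos⟩ := ((ht.eventually (isOpen_interior.mem_nhds h0)).and
    self_mem_nhdsWithin).exists
  have htpos : 0 < t := htpos
  simpa [smul_smul, htpos.ne'] using F.f2 _ (interior_subset ht) t⁻¹ (inv_pos.2 htpos)

lemma neg_mem_intMats_of_notMem_dual (F : ConeSubequation n) {A : Matrix (Fin n) (Fin n) ℝ}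
    (hs : A.IsSymm) (hA : A ∉ Subtype.val '' dualSet F.carrier) : -A ∈ F.intMats := by
  have hsa : A ∈ selfAdjoint (Matrix (Fin n) (Fin n) ℝ) := by
    rw [selfAdjoint.mem_iff]; exact hs
  by_contra hc
  refine hA ⟨⟨A, hsa⟩, fun hint => hc ⟨_, hint, rfl⟩, rfl⟩

lemma dual_smul (F : ConeSubequation n) {A : Matrix (Fin n) (Fin n) ℝ}
    (hA : A ∈ Subtype.val '' dualSet F.carrier) {t : ℝ} (ht : 0 < t) :
    t • A ∈ Subtype.val '' dualSet F.carrier := by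
  obtain ⟨B, hB, rfl⟩ := hA
  refine ⟨t • B, fun hint => hB ?_, rfl⟩
  simpa [smul_smul, ht.ne'] using F.interior_smul hint (inv_pos.2 ht)

lemma posSemidef_mem_dual (F : ConeSubequation n) {A : Matrix (Fin n) (Fin n) ℝ}
    (hA : A.PosSemidef) : A ∈ Subtype.val '' dualSet F.carrier := by
  refine ⟨⟨A, hA.isHermitian⟩, fun hint => F.zero_notMem_interior ?_, rfl⟩
  simpa using F.interior_add (P := ⟨A, hA.isHermitian⟩) hint hA

end ConeSubequation

section Hessian

lemma hessMatrix_apply (f : EucSp n → ℝ) (x : EucSp n) (i j : Fin n) :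
    hessMatrix f x i j =
      fderiv ℝ (fderiv ℝ f) x (EuclideanSpace.single i 1) (EuclideanSpace.single j 1) := by
  simp [hessMatrix, iteratedFDeriv_two_apply]

lemma dotProduct_hessMatrix (f : EucSp n → ℝ) (x v w : EucSp n) :
    v.ofLp ⬝ᵥ (hessMatrix f x).mulVec w.ofLp = fderiv ℝ (fderiv ℝ f) x v w := by
  have hsum : ∀ u : EucSp n, u = ∑ i, u i • EuclideanSpace.single i (1 : ℝ) := by
    intro u
    ext k
    simp [Pi.single_apply]
  conv_rhs => rw [hsum v, hsum w]
  simp only [map_sum, map_smul, sum_apply, smul_apply,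
    dotProduct, Matrix.mulVec, hessMatrix_apply, smul_eq_mul]
  simp only [Finset.mul_sum]
  rw [Finset.sum_comm]
  refine Finset.sum_congr rfl fun i _ => ?_
  refine Finset.sum_congr rfl fun j _ => ?_
  ring

lemma hessMatrix_isSymm {f : EucSp n → ℝ} {x : EucSp n} (hf : ContDiffAt ℝ 2 f x) :
    (hessMatrix f x).IsSymm := by
  ext i j
  rw [Matrix.transpose_apply, hessMatrix_apply, hessMatrix_apply]
  exact hf.isSymmSndFDerivAt (by simp) _ _

lemma hessMatrix_add {f g : EucSp n → ℝ} {x : EucSp n} (hf : ContDiffAt ℝ 2 f x)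
    (hg : ContDiffAt ℝ 2 g x) :
    hessMatrix (fun y => f y + g y) x = hessMatrix f x + hessMatrix g x := by
  ext i j
  have := iteratedFDeriv_add_apply (𝕜 := ℝ) (i := 2) hf hg
  change iteratedFDeriv ℝ 2 (f + g) x _ = _
  rw [this]
  rfl

lemma hessMatrix_neg (f : EucSp n → ℝ) (x : EucSp n) :
    hessMatrix (fun y => -f y) x = -hessMatrix f x := by
  ext i j
  have := iteratedFDeriv_neg_apply (𝕜 := ℝ) (i := 2) (f := f) (x := x)
  change iteratedFDeriv ℝ 2 (-f) x _ = _
  rw [this]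
  rfl

lemma hessMatrix_const_mul {f : EucSp n → ℝ} {x : EucSp n} (hf : ContDiffAt ℝ 2 f x) (c : ℝ) :
    hessMatrix (fun y => c * f y) x = c • hessMatrix f x := by
  ext i j
  have := iteratedFDeriv_const_smul_apply (𝕜 := ℝ) (i := 2) (a := c) hf
  change iteratedFDeriv ℝ 2 (c • f) x _ = _
  rw [this]
  rfl

lemma hessMatrix_const (c : ℝ) (x : EucSp n) : hessMatrix (fun _ => c) x = 0 := by
  ext i j
  simp [hessMatrix_apply]

lemma hessMatrix_add_const {f : EucSp n → ℝ} {x : EucSp n} (hf : ContDiffAt ℝ 2 f x) (c : ℝ) :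
    hessMatrix (fun y => f y + c) x = hessMatrix f x := by
  rw [hessMatrix_add hf contDiffAt_const, hessMatrix_const, add_zero]

lemma hessMatrix_comp_add (f : EucSp n → ℝ) (a x : EucSp n) :
    hessMatrix (fun y => f (y + a)) x = hessMatrix f (x + a) := by
  ext i j
  simp [hessMatrix, iteratedFDeriv_comp_add_right]

lemma continuousAt_hessMatrix {f : EucSp n → ℝ} {x : EucSp n} (hf : ContDiffAt ℝ 2 f x) :
    ContinuousAt (hessMatrix f) x := by
  have h := hf.continuousAt_iteratedFDeriv (k := 2) le_rfl
  refine continuousAt_pi.2 fun i => continuousAt_pi.2 fun j => ?_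
  have hev : Continuous fun L : (EucSp n) [×2]→L[ℝ] ℝ =>
      L ![EuclideanSpace.single i 1, EuclideanSpace.single j 1] :=
    continuous_eval_const _
  exact hev.continuousAt.comp h

lemma contDiff_sqDist (p : EucSp n) : ContDiff ℝ 2 fun y : EucSp n => ‖y - p‖ ^ 2 :=
  (contDiff_id.sub contDiff_const).norm_sq ℝ

lemma hessMatrix_sqDist (p x : EucSp n) :
    hessMatrix (fun y => ‖y - p‖ ^ 2) x = (2 : ℝ) • 1 := by
  have h1 : fderiv ℝ (fun y : EucSp n => ‖y - p‖ ^ 2) =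
      fun y => (2 : ℝ) • innerSL ℝ (y - p) := by
    ext1 y
    have h := ((hasFDerivAt_id y).sub_const p).norm_sq
    exact h.fderiv.trans (by ext; simp)
  have h2 : fderiv ℝ (fun y : EucSp n => (2 : ℝ) • innerSL ℝ (y - p)) x =
      (2 : ℝ) • innerSL ℝ := by
    have h := (((innerSL ℝ (E := EucSp n)).hasFDerivAt (x := x - p)).comp x
      ((hasFDerivAt_id x).sub_const p)).const_smul (2 : ℝ)
    exact h.fderiv.trans (by ext; simp)
  ext i j
  rw [hessMatrix_apply, h1, h2]
  change 2 * inner ℝ (EuclideanSpace.single i (1 : ℝ)) (EuclideanSpace.single j (1 : ℝ)) = _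
  by_cases hij : i = j
  · subst hij; simp
  · simp [hij, EuclideanSpace.inner_single_left]

lemma hessMatrix_posSemidef_of_isLocalMin {f : EucSp n → ℝ} {x : EucSp n}
    (hf : ContDiffAt ℝ 2 f x) (hmin : IsLocalMin f x) : (hessMatrix f x).PosSemidef := by
  refine Matrix.PosSemidef.of_dotProduct_mulVec_nonneg (hessMatrix_isSymm hf) fun v' => ?_
  obtain ⟨v, rfl⟩ : ∃ v : EucSp n, v.ofLp = v' := ⟨WithLp.toLp 2 v', rfl⟩
  rw [star_trivial, dotProduct_hessMatrix]
  by_contra hneg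
  push Not at hneg
  let a := fderiv ℝ (fderiv ℝ f) x v v
  have hneg : a < 0 := hneg
  have hline : ∀ t : ℝ, HasDerivAt (fun t : ℝ => x + t • v) v t := fun t => by
    simpa using ((hasDerivAt_id t).smul_const v).const_add x
  have hcont : Tendsto (fun t : ℝ => x + t • v) (𝓝 0) (𝓝 x) := by
    simpa using (hline 0).continuousAt.tendsto
  have hdf : ∀ᶠ t : ℝ in 𝓝 0, DifferentiableAt ℝ f (x + t • v) :=
    hcont.eventually ((hf.eventually (by simp)).mono fun y hy =>
      hy.differentiableAt (by simp))
  let k : ℝ → ℝ := fun t => -f (x + t • v) + a / 4 * t ^ 2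
  have hderiv : deriv k =ᶠ[𝓝 0] fun t => -fderiv ℝ f (x + t • v) v + a / 2 * t := by
    filter_upwards [hdf] with t ht
    have h1 : HasDerivAt (fun t : ℝ => f (x + t • v)) (fderiv ℝ f (x + t • v) v) t :=
      ht.hasFDerivAt.comp_hasDerivAt t (hline t)
    have h2 : HasDerivAt (fun t : ℝ => a / 4 * t ^ 2) (a / 2 * t) t := by
      have h3 : a / 4 * (((2 : ℕ) : ℝ) * t ^ (2 - 1)) = a / 2 * t := by norm_num; ring
      rw [← h3]
      exact (hasDerivAt_pow 2 t).const_mul (a / 4)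
    exact (h1.neg.add h2).deriv
  have hd2 : HasDerivAt (fun t => -fderiv ℝ f (x + t • v) v + a / 2 * t) (-a + a / 2) 0 := by
    have hdiff : DifferentiableAt ℝ (fderiv ℝ f) x :=
      (hf.fderiv_right (m := 1) (by norm_num)).differentiableAt (by simp)
    have hfd : HasFDerivAt (fun y => fderiv ℝ f y v)
        ((ContinuousLinearMap.apply ℝ ℝ v).comp (fderiv ℝ (fderiv ℝ f) x)) x :=
      (ContinuousLinearMap.apply ℝ ℝ v).hasFDerivAt.comp x hdiff.hasFDerivAt
    have hx0 : x = x + (0 : ℝ) • v := by simp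
    have h1 : HasDerivAt (fun t : ℝ => fderiv ℝ f (x + t • v) v) a 0 :=
      HasFDerivAt.comp_hasDerivAt_of_eq (0 : ℝ) hfd (hline 0) hx0
    have h2 : HasDerivAt (fun t : ℝ => a / 2 * t) (a / 2) 0 := by
      simpa using (hasDerivAt_id (0 : ℝ)).const_mul (a / 2)
    exact h1.neg.add h2
  have hkmin : IsLocalMin k 0 := by
    refine isLocalMin_of_deriv_deriv_pos ?_ ?_ ?_
    · rw [hderiv.deriv_eq, hd2.deriv]; linarith
    · rw [hderiv.eq_of_nhds]; simp [hmin.fderiv_eq_zero]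
    · have h1 : ContinuousAt f (x + (0 : ℝ) • v) := by simpa using hf.continuousAt
      have h2 : ContinuousAt (fun t : ℝ => f (x + t • v)) 0 :=
        ContinuousAt.comp (f := fun t : ℝ => x + t • v) h1 (hline 0).continuousAt
      exact h2.neg.add (by fun_prop)
  have hboth := hkmin.and (hcont.eventually hmin)
  obtain ⟨t, ⟨ht1, ht2⟩, ht0⟩ :=
    ((hboth.filter_mono nhdsWithin_le_nhds).and
      (self_mem_nhdsWithin (a := (0 : ℝ)) (s := {0}ᶜ))).exists
  have ht0 : 0 < t ^ 2 := by
    have : t ≠ 0 := ht0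
    positivity
  simp only [k, zero_smul, add_zero] at ht1
  nlinarith [mul_pos (neg_pos.2 hneg) ht0]

end Hessian

section BoundaryBarrier

lemma projMat_mulVec (e : EucSp n) (v : Fin n → ℝ) :
    (projMat e).mulVec v = (e.ofLp ⬝ᵥ v) • e.ofLp := by
  ext i
  simp only [Matrix.mulVec, dotProduct, projMat, Matrix.of_apply, Pi.smul_apply, smul_eq_mul,
    Finset.sum_mul]
  exact Finset.sum_congr rfl fun j _ => by ring

lemma projMat_isSymm (e : EucSp n) : (projMat e).IsSymm := by
  ext i j
  simp [projMat, mul_comm]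

lemma ConeSubequation.eventually_add_smul_projMat_mem (F : ConeSubequation n)
    {D : Matrix (Fin n) (Fin n) ℝ} (hD : D.IsSymm) (e : EucSp n) (t₀ : ℝ)
    (h : (1 - projMat e) * D * (1 - projMat e) + t₀ • projMat e ∈ F.intMats) :
    ∀ᶠ s : ℝ in atTop, D + s • projMat e ∈ F.intMats := by
  set B := (1 - projMat e) * D * (1 - projMat e) with hB
  have hP := projMat_isSymm e
  have h1s : ((1 : Matrix (Fin n) (Fin n) ℝ) - projMat e).IsSymm := Matrix.isSymm_one.sub hP
  have hBs : B.IsSymm := by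
    rw [Matrix.IsSymm, hB, Matrix.transpose_mul, Matrix.transpose_mul, hD.eq, h1s.eq,
      Matrix.mul_assoc]
  obtain ⟨η, hη, hηpos⟩ : ∃ η : ℝ, B + t₀ • projMat e - η • 1 ∈ F.intMats ∧ 0 < η := by
    have ht : Tendsto (fun η : ℝ => B + t₀ • projMat e - η • (1 : Matrix (Fin n) (Fin n) ℝ))
        (𝓝[>] 0) (𝓝 (B + t₀ • projMat e)) := by
      have : Continuous fun η : ℝ =>
        B + t₀ • projMat e - η • (1 : Matrix (Fin n) (Fin n) ℝ) := by fun_prop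
      simpa using (this.tendsto 0).mono_left (nhdsWithin_le_nhds (s := Set.Ioi 0))
    have hs : ∀ η : ℝ, (B + t₀ • projMat e - η • (1 : Matrix (Fin n) (Fin n) ℝ)).IsSymm :=
      fun η => (hBs.add (hP.smul t₀)).sub (Matrix.isSymm_one.smul η)
    exact ((F.eventually_mem_intMats ht (Eventually.of_forall hs) h).and
      self_mem_nhdsWithin).exists
  set r := D.mulVec e.ofLp with hr
  filter_upwards [eventually_ge_atTop (t₀ + (η⁻¹ * (r ⬝ᵥ r) + e.ofLp ⬝ᵥ r))] with s hs
  have hdecomp : D + s • projMat e = (B + t₀ • projMat e - η • 1) +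
      (D - B + (s - t₀) • projMat e + η • 1) := by
    rw [sub_smul]; abel
  rw [hdecomp]
  refine F.intMats_add hη (Matrix.PosSemidef.of_dotProduct_mulVec_nonneg ?_ fun v => ?_)
  · exact ((hD.sub hBs).add (hP.smul _)).add (Matrix.isSymm_one.smul η)
  set a := e.ofLp ⬝ᵥ v with ha
  have hav : v ⬝ᵥ e.ofLp = a := dotProduct_comm _ _
  have hDe : e.ofLp ⬝ᵥ D.mulVec v = v ⬝ᵥ r := by
    rw [Matrix.dotProduct_mulVec, ← Matrix.mulVec_transpose, hD.eq, dotProduct_comm]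
  have hrv : r ⬝ᵥ v = v ⬝ᵥ r := dotProduct_comm _ _
  have hBv : v ⬝ᵥ B.mulVec v = v ⬝ᵥ D.mulVec v - 2 * a * (v ⬝ᵥ r) + a ^ 2 * (e.ofLp ⬝ᵥ r) := by
    rw [hB, ← Matrix.mulVec_mulVec, ← Matrix.mulVec_mulVec, Matrix.sub_mulVec, Matrix.sub_mulVec,
      Matrix.one_mulVec, Matrix.one_mulVec, projMat_mulVec, projMat_mulVec, ← ha,
      Matrix.mulVec_sub, Matrix.mulVec_smul, ← hr]
    simp only [dotProduct_sub, dotProduct_smul, smul_eq_mul, hDe, hav]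
    ring
  have hsq : 0 ≤ (η • v + a • r) ⬝ᵥ (η • v + a • r) := by
    simpa using dotProduct_star_self_nonneg (η • v + a • r)
  have hsq' : 0 ≤ η * (v ⬝ᵥ v) + 2 * a * (v ⬝ᵥ r) + a ^ 2 * (η⁻¹ * (r ⬝ᵥ r)) := by
    have h2 := mul_nonneg (inv_nonneg.2 hηpos.le) hsq
    simp only [dotProduct_add, add_dotProduct, dotProduct_smul, smul_dotProduct, smul_eq_mul,
      hrv] at h2
    have h3 : η⁻¹ * (η * (η * v ⬝ᵥ v) + a * (η * v ⬝ᵥ r) + (η * (a * v ⬝ᵥ r) + a * (a * r ⬝ᵥ r)))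
        = η * (v ⬝ᵥ v) + 2 * a * (v ⬝ᵥ r) + a ^ 2 * (η⁻¹ * (r ⬝ᵥ r)) := by
      field_simp
      ring
    linarith
  have hs' : 0 ≤ (s - t₀ - (η⁻¹ * (r ⬝ᵥ r) + e.ofLp ⬝ᵥ r)) * a ^ 2 :=
    mul_nonneg (by linarith) (sq_nonneg a)
  simp only [star_trivial, Matrix.add_mulVec, Matrix.sub_mulVec, Matrix.smul_mulVec,
    Matrix.one_mulVec, projMat_mulVec, dotProduct_add, dotProduct_sub, dotProduct_smul, hBv,
    smul_eq_mul, ← ha, hav]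
  nlinarith

lemma ConeSubequation.eventually_neg_add_smul_projMat_notMem (F : ConeSubequation n)
    (D : Matrix (Fin n) (Fin n) ℝ) {e : EucSp n} (h : -projMat e ∉ F.mats) :
    ∀ᶠ s : ℝ in atTop, -(D + s • projMat e) ∉ F.mats := by
  have ht : Tendsto (fun s : ℝ => -(s⁻¹ • D + projMat e)) atTop (𝓝 (-projMat e)) := by
    have h1 : Tendsto (fun s : ℝ => s⁻¹ • D) atTop (𝓝 ((0 : ℝ) • D)) :=
      tendsto_inv_atTop_zero.smul_const D
    simpa using (h1.add_const (projMat e)).neg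
  filter_upwards [ht.eventually (F.isClosed_mats.isOpen_compl.mem_nhds h),
    eventually_gt_atTop 0] with s hs hspos hmem
  refine hs ?_
  have := F.mats_smul hmem (inv_pos.2 hspos)
  rwa [smul_neg, smul_add, smul_smul, inv_mul_cancel₀ hspos.ne', one_smul] at this

lemma gradient_apply_coord (ρ : EucSp n → ℝ) (x : EucSp n) (i : Fin n) :
    (gradient ρ x) i = fderiv ℝ ρ x (EuclideanSpace.single i 1) := by
  have h : inner ℝ (gradient ρ x) (EuclideanSpace.single i (1 : ℝ)) =
      fderiv ℝ ρ x (EuclideanSpace.single i 1) := by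
    simp [gradient]
  rw [← h, EuclideanSpace.inner_single_right]
  simp

lemma hessMatrix_sq_of_eq_zero {ρ : EucSp n → ℝ} (hρ : ContDiff ℝ 2 ρ) {x : EucSp n}
    (h0 : ρ x = 0) (hg : gradient ρ x ≠ 0) :
    hessMatrix (fun y => ρ y ^ 2) x =
      (2 * ‖gradient ρ x‖ ^ 2) • projMat (innerNormal ρ x) := by
  have hd : ∀ y, HasFDerivAt ρ (fderiv ℝ ρ y) y := fun y =>
    (hρ.differentiable (by simp) y).hasFDerivAt
  have h1 : fderiv ℝ (fun y => ρ y ^ 2) = fun y => (2 * ρ y) • fderiv ℝ ρ y := by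
    ext1 y
    have := (hd y).pow 2
    exact this.fderiv.trans (by simp)
  have hd2 : HasFDerivAt (fderiv ℝ ρ) (fderiv ℝ (fderiv ℝ ρ) x) x :=
    ((hρ.fderiv_right (m := 1) (by norm_num)).differentiable (by simp) x).hasFDerivAt
  have h2 := ((hd x).const_mul 2).smul hd2
  ext i j
  rw [hessMatrix_apply, h1]
  have h3 : fderiv ℝ (fun y => (2 * ρ y) • fderiv ℝ ρ y) x = _ := h2.fderiv
  rw [h3]
  have hg' : ‖gradient ρ x‖ ≠ 0 := norm_ne_zero_iff.2 hg
  simp [h0, innerNormal, projMat, gradient_apply_coord]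
  field_simp

lemma norm_innerNormal {ρ : EucSp n → ℝ} {x : EucSp n} (hg : gradient ρ x ≠ 0) :
    ‖innerNormal ρ x‖ = 1 := by
  rw [innerNormal, norm_neg, norm_smul, norm_inv, norm_norm,
    inv_mul_cancel₀ (norm_ne_zero_iff.2 hg)]

lemma exists_boundary_barrier (F : ConeSubequation n) (hF3 : CondF3 F) {ρ : EucSp n → ℝ}
    (hρ : ContDiff ℝ 2 ρ) {x₀ : EucSp n} (h0 : ρ x₀ = 0) (hg : gradient ρ x₀ ≠ 0)
    (hconv : ∃ t₀ : ℝ, ∀ t ≥ t₀,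
      secondFF ρ x₀ + t • projMat (innerNormal ρ x₀) ∈ F.intMats) :
    ∃ β : EucSp n → ℝ, ContDiff ℝ 2 β ∧ β x₀ = 0 ∧ hessMatrix β x₀ ∈ F.intMats ∧
      -hessMatrix β x₀ ∉ F.mats ∧
      ∃ δ > 0, ∀ᶠ y in 𝓝 x₀, ρ y ≤ 0 → β y ≤ -δ * ‖y - x₀‖ ^ 2 := by
  obtain ⟨t₀, ht₀⟩ := hconv
  set g := ‖gradient ρ x₀‖ with hgdef
  have hgpos : 0 < g := norm_pos_iff.2 hg
  set P := projMat (innerNormal ρ x₀) with hP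
  set D := g⁻¹ • hessMatrix ρ x₀ with hD
  have hρs := hessMatrix_isSymm (x := x₀) hρ.contDiffAt
  have hDs : D.IsSymm := hρs.smul _
  have hII : (1 - P) * D * (1 - P) + t₀ • P ∈ F.intMats := by
    have := ht₀ t₀ le_rfl
    rwa [secondFF, ← hgdef, ← hP, ← Matrix.smul_mul, ← Matrix.mul_smul] at this
  have hPF : -P ∉ F.mats := by
    rintro ⟨A, hA, hAP⟩
    refine hF3 _ (norm_innerNormal hg) ?_
    convert hA
    exact Subtype.ext hAP.symm
  obtain ⟨s, hs1, hs2⟩ := ((F.eventually_add_smul_projMat_mem hDs _ t₀ hII).and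
    (F.eventually_neg_add_smul_projMat_notMem D hPF)).exists
  set M := g • (D + s • P) with hM
  have hMs : M.IsSymm := (hDs.add ((projMat_isSymm _).smul s)).smul g
  have hM1 : M ∈ F.intMats := F.intMats_smul hs1 hgpos
  have hM2 : -M ∉ F.mats := fun hc => hs2 <| by
    have := F.mats_smul hc (inv_pos.2 hgpos)
    rwa [smul_neg, hM, smul_smul, inv_mul_cancel₀ hgpos.ne', one_smul] at this
  have hcont : Continuous fun δ : ℝ => M - (2 * δ) • (1 : Matrix (Fin n) (Fin n) ℝ) := by
    fun_prop
  have htend : Tendsto (fun δ : ℝ => M - (2 * δ) • (1 : Matrix (Fin n) (Fin n) ℝ))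
      (𝓝[>] 0) (𝓝 M) := by
    simpa using (hcont.tendsto 0).mono_left (nhdsWithin_le_nhds (s := Set.Ioi 0))
  obtain ⟨δ, ⟨hδ1, hδ2⟩, hδ⟩ := (((F.eventually_mem_intMats htend (Eventually.of_forall
    fun δ => hMs.sub (Matrix.isSymm_one.smul _)) hM1).and
    (htend.neg.eventually (F.isClosed_mats.isOpen_compl.mem_nhds hM2))).and
    self_mem_nhdsWithin).exists
  have hρ2 : ContDiff ℝ 2 fun y => ρ y ^ 2 := hρ.pow 2
  have hsd := contDiff_sqDist x₀
  have hhess : hessMatrix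
      (fun y => (ρ y + s / (2 * g) * ρ y ^ 2) + -δ * ‖y - x₀‖ ^ 2) x₀ = M - (2 * δ) • 1 := by
    rw [hessMatrix_add (hρ.add (contDiff_const.mul hρ2)).contDiffAt
      (contDiff_const.mul hsd).contDiffAt, hessMatrix_add hρ.contDiffAt
      (contDiff_const.mul hρ2).contDiffAt, hessMatrix_const_mul hρ2.contDiffAt,
      hessMatrix_const_mul hsd.contDiffAt, hessMatrix_sqDist,
      hessMatrix_sq_of_eq_zero hρ h0 hg, hM, hD, ← hP, ← hgdef]
    rw [smul_add, smul_smul, smul_smul, smul_smul, smul_smul, mul_inv_cancel₀ hgpos.ne', one_smul,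
      show s / (2 * g) * (2 * g ^ 2) = g * s by field_simp, sub_eq_add_neg, ← neg_smul]
    ring_nf
  refine ⟨fun y => (ρ y + s / (2 * g) * ρ y ^ 2) + -δ * ‖y - x₀‖ ^ 2,
    (hρ.add (contDiff_const.mul hρ2)).add (contDiff_const.mul hsd), ?_, ?_, ?_, δ, hδ, ?_⟩
  · simp [h0]
  · rw [hhess]; exact hδ1
  · rw [hhess]; exact hδ2
  · have hc : Tendsto (fun y => 1 + s / (2 * g) * ρ y) (𝓝 x₀) (𝓝 1) := by
      have : Continuous fun y => 1 + s / (2 * g) * ρ y := by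
        have := hρ.continuous
        fun_prop
      simpa [h0] using this.tendsto x₀
    filter_upwards [hc.eventually (lt_mem_nhds one_pos)] with y hy hρy
    nlinarith [mul_nonneg (neg_nonneg.2 hρy) hy.le]

end BoundaryBarrier

section Viscosity

/-- The test-function condition for real-valued functions, with tests relative to full
neighborhoods. -/
def ViscSub (S : Set (SymMat n)) (X : Set (EucSp n)) (u : EucSp n → ℝ) : Prop :=
  ∀ p ∈ X, ∀ ψ : EucSp n → ℝ, ContDiffAt ℝ 2 ψ p → (∀ᶠ y in 𝓝 p, u y ≤ ψ y) → u p = ψ p →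
    hessMatrix ψ p ∈ Subtype.val '' S

lemma FSubharmonicOn.viscSub {S : Set (SymMat n)} {X : Set (EucSp n)} {u : EucSp n → ℝ}
    (h : FSubharmonicOn S X (fun y => (u y : EReal))) : ViscSub S X u := by
  intro p hp ψ hψ hle heq
  refine h.2.2 p hp ψ ⟨hψ, ?_, ?_⟩
  · exact (hle.filter_mono nhdsWithin_le_nhds).mono fun y hy => EReal.coe_le_coe_iff.2 hy
  · exact congrArg _ heq

lemma ViscSub.fSubharmonicOn {S : Set (SymMat n)} {X : Set (EucSp n)} {u : EucSp n → ℝ}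
    (h : ViscSub S X u) (hX : IsOpen X) (hu : ContinuousOn u X) :
    FSubharmonicOn S X (fun y => (u y : EReal)) := by
  refine ⟨(continuous_coe_real_ereal.comp_continuousOn hu).upperSemicontinuousOn,
    fun y _ => EReal.coe_ne_top _, fun p hp ψ hψ => h p hp ψ hψ.1 ?_ ?_⟩
  · have := hψ.2.1
    rw [hX.nhdsWithin_eq hp] at this
    exact this.mono fun y hy => EReal.coe_le_coe_iff.1 hy
  · exact EReal.coe_eq_coe_iff.1 hψ.2.2

lemma ViscSub.mono {S : Set (SymMat n)} {X Z : Set (EucSp n)} {u : EucSp n → ℝ}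
    (h : ViscSub S X u) (hZ : Z ⊆ X) : ViscSub S Z u :=
  fun p hp => h p (hZ hp)

lemma ViscSub.of_touching {S : Set (SymMat n)} {X : Set (EucSp n)} {u : EucSp n → ℝ}
    (h : ∀ p ∈ X, ∃ v, ViscSub S {p} v ∧ v p = u p ∧ ∀ᶠ y in 𝓝 p, v y ≤ u y) :
    ViscSub S X u := by
  intro p hp ψ hψ hle heq
  obtain ⟨v, hv, hvp, hvu⟩ := h p hp
  exact hv p rfl ψ hψ (hle.mp (hvu.mono fun y h1 h2 => h1.trans h2)) (hvp.trans heq)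

lemma ViscSub.comp_add_sub {S : Set (SymMat n)} {X : Set (EucSp n)} {u : EucSp n → ℝ}
    (h : ViscSub S X u) (a : EucSp n) (η : ℝ) :
    ViscSub S {z | z + a ∈ X} (fun z => u (z + a) - η) := by
  intro p hp ψ hψ hle heq
  have hsub : ContDiffAt ℝ 2 (fun y => ψ (y + -a)) (p + a) := by
    have hψ' : ContDiffAt ℝ 2 ψ (p + a + -a) := by simpa using hψ
    exact hψ'.comp (p + a) (contDiffAt_id.add contDiffAt_const)
  have key := h (p + a) hp (fun y => ψ (y + -a) + η) (hsub.add contDiffAt_const) ?_ ?_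
  · rw [hessMatrix_add_const hsub, hessMatrix_comp_add] at key
    simpa using key
  · have ht : Tendsto (fun y => y + -a) (𝓝 (p + a)) (𝓝 p) := by
      have : Continuous fun y : EucSp n => y + -a := by fun_prop
      simpa using this.tendsto (p + a)
    filter_upwards [ht.eventually hle] with y hy
    simp only [neg_add_cancel_right] at hy
    linarith
  · simp only [add_neg_cancel_right]
    linarith

lemma ViscSub.dual_mul_add {F : ConeSubequation n} {X : Set (EucSp n)} {u : EucSp n → ℝ}
    (h : ViscSub (dualSet F.carrier) X u) {c : ℝ} (hc : 0 < c) (d : ℝ) :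
    ViscSub (dualSet F.carrier) X (fun y => c * u y + d) := by
  intro p hp ψ hψ hle heq
  have hψ' : ContDiffAt ℝ 2 (fun y => ψ y + -d) p := hψ.add contDiffAt_const
  have key := h p hp (fun y => c⁻¹ * (ψ y + -d)) (contDiffAt_const.mul hψ') ?_ ?_
  · rw [hessMatrix_const_mul hψ', hessMatrix_add_const hψ] at key
    simpa [smul_smul, hc.ne'] using F.dual_smul key hc
  · filter_upwards [hle] with y hy
    rw [le_inv_mul_iff₀ hc]
    linarith
  · rw [eq_inv_mul_iff_mul_eq₀ hc.ne']
    linarith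

lemma viscSub_dual_const (F : ConeSubequation n) (X : Set (EucSp n)) (c : ℝ) :
    ViscSub (dualSet F.carrier) X (fun _ => c) := by
  intro p _ ψ hψ hle heq
  refine F.posSemidef_mem_dual (hessMatrix_posSemidef_of_isLocalMin hψ ?_)
  filter_upwards [hle] with y hy
  rwa [← heq]

lemma viscSub_of_contDiffAt (F : ConeSubequation n) {X : Set (EucSp n)} {v : EucSp n → ℝ}
    (hv : ∀ p ∈ X, ContDiffAt ℝ 2 v p) (hmem : ∀ p ∈ X, hessMatrix v p ∈ F.mats) :
    ViscSub F.carrier X v := by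
  intro p hp ψ hψ hle heq
  have hd : ContDiffAt ℝ 2 (fun y => ψ y + -v y) p := hψ.add (hv p hp).neg
  have hpsd : (hessMatrix (fun y => ψ y + -v y) p).PosSemidef := by
    refine hessMatrix_posSemidef_of_isLocalMin hd ?_
    filter_upwards [hle] with y hy
    linarith
  rw [hessMatrix_add hψ (hv p hp).neg, hessMatrix_neg] at hpsd
  have := F.mats_add (hmem p hp) hpsd
  rwa [show hessMatrix v p + (hessMatrix ψ p + -hessMatrix v p) = hessMatrix ψ p by abel] at this

/-- Comparison of a subsolution with a function which is smooth and strictly not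
subharmonic wherever the inequality is not given. -/
lemma ViscSub.le_of_isCompact {F : ConeSubequation n} {X K : Set (EucSp n)}
    {u ψ : EucSp n → ℝ} (hu : ViscSub F.carrier X u) (hK : IsCompact K)
    (husc : UpperSemicontinuousOn u K) (hψ : ContinuousOn ψ K)
    (h : ∀ z ∈ K, u z ≤ ψ z ∨
      (z ∈ X ∧ K ∈ 𝓝 z ∧ ContDiffAt ℝ 2 ψ z ∧ hessMatrix ψ z ∉ F.mats)) :
    ∀ z ∈ K, u z ≤ ψ z := by
  intro z hz
  have husc' : UpperSemicontinuousOn (fun y => u y + -ψ y) K :=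
    husc.add hψ.neg.upperSemicontinuousOn
  obtain ⟨m, hmK, hm⟩ := husc'.exists_isMaxOn ⟨z, hz⟩ hK
  have hzm : u z + -ψ z ≤ u m + -ψ m := hm hz
  rcases h m hmK with hle | ⟨hmX, hKm, hψm, hnot⟩
  · linarith
  · refine absurd ?_ hnot
    have := hu m hmX (fun y => ψ y + (u m + -ψ m)) (hψm.add contDiffAt_const) ?_ (by ring)
    · rwa [hessMatrix_add_const hψm] at this
    · filter_upwards [hKm] with y hy
      have : u y + -ψ y ≤ u m + -ψ m := hm hy
      linarith

end Viscosity

section UpperEnvelope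

/-- The upper semicontinuous regularization, relative to `K`, of the supremum of a family of
functions. -/
def upperEnvelope (K : Set (EucSp n)) (𝓕 : Set (EucSp n → ℝ)) (x : EucSp n) : ℝ :=
  sInf {c : ℝ | ∀ᶠ y in 𝓝[K] x, ∀ u ∈ 𝓕, u y ≤ c}

variable {K : Set (EucSp n)} {𝓕 : Set (EucSp n → ℝ)} {h : EucSp n → ℝ} {x : EucSp n} {c : ℝ}

lemma le_of_eventually_forall_le (hx : x ∈ K) (hc : ∀ᶠ y in 𝓝[K] x, ∀ u ∈ 𝓕, u y ≤ c)
    {u : EucSp n → ℝ} (hu : u ∈ 𝓕) : u x ≤ c :=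
  hc.self_of_nhdsWithin hx u hu

lemma upperEnvelope_le (hh : h ∈ 𝓕) (hx : x ∈ K) (hc : ∀ᶠ y in 𝓝[K] x, ∀ u ∈ 𝓕, u y ≤ c) :
    upperEnvelope K 𝓕 x ≤ c :=
  csInf_le ⟨h x, fun _ hc => le_of_eventually_forall_le hx hc hh⟩ hc

variable {M : ℝ}

lemma le_upperEnvelope (hM : ∀ u ∈ 𝓕, ∀ y ∈ K, u y ≤ M) (hx : x ∈ K) {u : EucSp n → ℝ}
    (hu : u ∈ 𝓕) : u x ≤ upperEnvelope K 𝓕 x := by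
  refine le_csInf ⟨M, ?_⟩ fun c hc => le_of_eventually_forall_le hx hc hu
  filter_upwards [self_mem_nhdsWithin] with y hy u hu using hM u hu y hy

lemma eventually_forall_le_of_upperEnvelope_lt (hM : ∀ u ∈ 𝓕, ∀ y ∈ K, u y ≤ M)
    (hc : upperEnvelope K 𝓕 x < c) : ∀ᶠ y in 𝓝[K] x, ∀ u ∈ 𝓕, u y ≤ c := by
  obtain ⟨c', hc', hlt⟩ := exists_lt_of_csInf_lt
    (⟨M, by filter_upwards [self_mem_nhdsWithin] with y hy u hu using hM u hu y hy⟩) hc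
  filter_upwards [hc'] with y hy u hu using (hy u hu).trans hlt.le

lemma eventually_upperEnvelope_le (hh : h ∈ 𝓕) (hc : ∀ᶠ y in 𝓝[K] x, ∀ u ∈ 𝓕, u y ≤ c) :
    ∀ᶠ y in 𝓝[K] x, upperEnvelope K 𝓕 y ≤ c := by
  filter_upwards [eventually_eventually_nhdsWithin.2 hc, self_mem_nhdsWithin] with y hy hyK
  exact upperEnvelope_le hh hyK hy

lemma upperSemicontinuousOn_upperEnvelope (hh : h ∈ 𝓕) (hM : ∀ u ∈ 𝓕, ∀ y ∈ K, u y ≤ M) :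
    UpperSemicontinuousOn (upperEnvelope K 𝓕) K := by
  rw [upperSemicontinuousOn_iff]
  intro x _
  rw [upperSemicontinuousWithinAt_iff]
  intro c hc
  obtain ⟨c', h1, h2⟩ := exists_between hc
  filter_upwards [eventually_upperEnvelope_le hh
    (eventually_forall_le_of_upperEnvelope_lt hM h1)] with y hy
  exact hy.trans_lt h2

lemma viscSub_upperEnvelope {F : ConeSubequation n} {X : Set (EucSp n)} (hX : IsOpen X)
    (hXK : X ⊆ K) (hh : h ∈ 𝓕) (hM : ∀ u ∈ 𝓕, ∀ y ∈ K, u y ≤ M)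
    (husc : ∀ u ∈ 𝓕, UpperSemicontinuousOn u K) (hvisc : ∀ u ∈ 𝓕, ViscSub F.carrier X u) :
    ViscSub F.carrier X (upperEnvelope K 𝓕) := by
  intro p hp ψ hψ hle heq
  change _ ∈ F.mats
  by_contra hnot
  have hsd := contDiff_sqDist p
  have hψε : ∀ ε : ℝ, ∀ y, ContDiffAt ℝ 2 ψ y →
      ContDiffAt ℝ 2 (fun y => ψ y + ε * ‖y - p‖ ^ 2) y ∧
      hessMatrix (fun y => ψ y + ε * ‖y - p‖ ^ 2) y = hessMatrix ψ y + ε • (2 : ℝ) • 1 := by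
    intro ε y hy
    have h2 : ContDiffAt ℝ 2 (fun y => ε * ‖y - p‖ ^ 2) y := (contDiff_const.mul hsd).contDiffAt
    exact ⟨hy.add h2, by rw [hessMatrix_add hy h2, hessMatrix_const_mul hsd.contDiffAt,
      hessMatrix_sqDist]⟩
  obtain ⟨ε, hε, hεpos⟩ : ∃ ε : ℝ, hessMatrix ψ p + ε • (2 : ℝ) • 1 ∉ F.mats ∧ 0 < ε := by
    have hc : Continuous fun ε : ℝ =>
        hessMatrix ψ p + ε • (2 : ℝ) • (1 : Matrix (Fin n) (Fin n) ℝ) := by fun_prop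
    have ht : Tendsto (fun ε : ℝ =>
        hessMatrix ψ p + ε • (2 : ℝ) • (1 : Matrix (Fin n) (Fin n) ℝ)) (𝓝[>] 0)
        (𝓝 (hessMatrix ψ p)) := by
      simpa using (hc.tendsto 0).mono_left (nhdsWithin_le_nhds (s := Set.Ioi 0))
    exact ((ht.eventually (F.isClosed_mats.isOpen_compl.mem_nhds hnot)).and
      self_mem_nhdsWithin).exists
  have hcd : ∀ᶠ y in 𝓝 p, ContDiffAt ℝ 2 ψ y := hψ.eventually (by simp)
  have hnear : ∀ᶠ y in 𝓝 p, hessMatrix ψ y + ε • (2 : ℝ) • 1 ∉ F.mats :=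
    ((continuousAt_hessMatrix hψ).add_const (ε • (2 : ℝ) • 1)).eventually
      (F.isClosed_mats.isOpen_compl.mem_nhds hε)
  obtain ⟨r, hr, hball⟩ := Metric.nhds_basis_closedBall.eventually_iff.1
    (((hcd.and hnear).and hle).and (hX.mem_nhds hp))
  have hcmp : ∀ u ∈ 𝓕, ∀ z ∈ Metric.closedBall p r,
      u z ≤ (ψ z + ε * ‖z - p‖ ^ 2) + -(ε * r ^ 2) := by
    intro u hu
    refine (hvisc u hu).le_of_isCompact (isCompact_closedBall p r)
      ((husc u hu).mono fun z hz => hXK (hball hz).2) ?_ ?_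
    · intro z hz
      exact ((hψε ε z (hball hz).1.1.1).1.continuousAt.add
        continuousAt_const).continuousWithinAt
    · intro z hz
      obtain ⟨⟨⟨h1, h2⟩, h3⟩, h4⟩ := hball hz
      by_cases hzr : z ∈ Metric.ball p r
      · right
        refine ⟨h4, mem_of_superset (Metric.isOpen_ball.mem_nhds hzr)
          Metric.ball_subset_closedBall, (hψε ε z h1).1.add contDiffAt_const, ?_⟩
        rwa [hessMatrix_add_const (hψε ε z h1).1, (hψε ε z h1).2]
      · left
        have hdist : ‖z - p‖ = r := by
          rw [← dist_eq_norm]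
          exact le_antisymm hz (not_lt.1 hzr)
        rw [hdist]
        linarith [le_upperEnvelope hM (hXK h4) hu]
  have hcontr : upperEnvelope K 𝓕 p ≤ ψ p + -(ε * r ^ 2) / 2 := by
    refine upperEnvelope_le hh (hXK hp) (nhdsWithin_le_nhds ?_)
    have hlt : (ψ p + ε * ‖p - p‖ ^ 2) + -(ε * r ^ 2) < ψ p + -(ε * r ^ 2) / 2 := by
      have : 0 < ε * r ^ 2 := by positivity
      simp
      linarith
    have hcts : ContinuousAt (fun z => (ψ z + ε * ‖z - p‖ ^ 2) + -(ε * r ^ 2)) p :=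
      (hψε ε p hψ).1.continuousAt.add continuousAt_const
    filter_upwards [hcts.eventually (gt_mem_nhds hlt), Metric.closedBall_mem_nhds p hr]
      with z hz1 hz2 u hu
    exact (hcmp u hu z hz2).trans hz1.le
  have : 0 < ε * r ^ 2 := by positivity
  linarith

end UpperEnvelope

section Perron

/-- The data of an obstacle Dirichlet problem: a subsolution `h` and a supersolution `w` on the
open part `Y` of a compact set `K`, agreeing on `K \ Y` except on the part `B`, where there are
barriers and boundary values `φ` are prescribed. -/
structure PerronData (F : ConeSubequation n) (K Y B : Set (EucSp n)) (h w φ : EucSp n → ℝ) :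
    Prop where
  isCompact : IsCompact K
  isOpen : IsOpen Y
  subset : Y ⊆ K
  boundary_subset : B ⊆ K
  notMem : ∀ y ∈ B, y ∉ Y
  cont_sub : ContinuousOn h K
  visc_sub : ViscSub F.carrier Y h
  cont_super : ContinuousOn w K
  visc_super : ViscSub (dualSet F.carrier) Y (fun y => -w y)
  cont_bdry : ContinuousOn φ B
  sub_le : ∀ y ∈ K, h y ≤ w y
  sub_le_bdry : ∀ y ∈ B, h y ≤ φ y
  bdry_le : ∀ y ∈ B, φ y ≤ w y
  super_eq : ∀ y ∈ K, y ∉ Y → y ∉ B → w y = h y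
  barrier : ∀ q ∈ B, ∃ β : EucSp n → ℝ, ContDiff ℝ 2 β ∧ β q = 0 ∧ hessMatrix β q ∈ F.intMats ∧
    -hessMatrix β q ∉ F.mats ∧ ∃ δ > 0, ∀ᶠ y in 𝓝[K] q, β y ≤ -δ * ‖y - q‖ ^ 2

/-- The Perron family of subsolutions above `h`, below `w`, with boundary values at most `φ`. -/
def perronFamily (F : ConeSubequation n) (K Y B : Set (EucSp n)) (h w φ : EucSp n → ℝ) :
    Set (EucSp n → ℝ) :=
  {u | UpperSemicontinuousOn u K ∧ ViscSub F.carrier Y u ∧ (∀ y ∈ K, h y ≤ u y) ∧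
    (∀ y ∈ K, u y ≤ w y) ∧ ∀ y ∈ B, u y ≤ φ y}

/-- The Perron function. -/
def perronSol (F : ConeSubequation n) (K Y B : Set (EucSp n)) (h w φ : EucSp n → ℝ) :
    EucSp n → ℝ :=
  upperEnvelope K (perronFamily F K Y B h w φ)

lemma exists_pos_le_mul {a : ℝ} (ha : 0 < a) (b : ℝ) : ∃ C > 0, b ≤ C * a := by
  refine ⟨(|b| + 1) / a, by positivity, ?_⟩
  rw [div_mul_cancel₀ _ ha.ne']
  linarith [le_abs_self b]

namespace PerronData

variable {F : ConeSubequation n} {K Y B : Set (EucSp n)} {h w φ : EucSp n → ℝ}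

local notation "𝓢" => perronFamily F K Y B h w φ
local notation "𝓗" => perronSol F K Y B h w φ

lemma sub_mem (D : PerronData F K Y B h w φ) : h ∈ 𝓢 :=
  ⟨D.cont_sub.upperSemicontinuousOn, D.visc_sub, fun _ _ => le_rfl, D.sub_le, D.sub_le_bdry⟩

lemma exists_bound (D : PerronData F K Y B h w φ) : ∃ M, ∀ u ∈ 𝓢, ∀ y ∈ K, u y ≤ M := by
  obtain ⟨M, hM⟩ := (D.isCompact.image_of_continuousOn D.cont_super).bddAbove
  exact ⟨M, fun u hu y hy => (hu.2.2.2.1 y hy).trans (hM (Set.mem_image_of_mem _ hy))⟩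

lemma le_sol (D : PerronData F K Y B h w φ)
    {u : EucSp n → ℝ} (hu : u ∈ 𝓢) {y : EucSp n} (hy : y ∈ K) : u y ≤ 𝓗 y := by
  obtain ⟨M, hM⟩ := D.exists_bound
  exact le_upperEnvelope hM hy hu

lemma sol_le_super (D : PerronData F K Y B h w φ) {y : EucSp n} (hy : y ∈ K) : 𝓗 y ≤ w y := by
  refine le_of_forall_gt_imp_ge_of_dense fun c hc => upperEnvelope_le D.sub_mem hy ?_
  filter_upwards [(D.cont_super y hy).eventually (gt_mem_nhds hc), self_mem_nhdsWithin]
    with z hz hzK u hu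
  exact (hu.2.2.2.1 z hzK).trans hz.le

lemma eventually_le_bdry (D : PerronData F K Y B h w φ)
    {q : EucSp n} (hq : q ∈ B) {ε : ℝ} (hε : 0 < ε) :
    ∀ᶠ y in 𝓝[K] q, ∀ u ∈ 𝓢, u y ≤ φ q + ε := by
  obtain ⟨M, hM⟩ := D.exists_bound
  obtain ⟨β, hβ, hβ0, -, hnot, δ, hδ, hle⟩ := D.barrier q hq
  have hqK := D.boundary_subset hq
  have e1 : ∀ᶠ z in 𝓝 q, -hessMatrix β z ∉ F.mats :=
    (continuousAt_hessMatrix hβ.contDiffAt).neg.eventually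
      (F.isClosed_mats.isOpen_compl.mem_nhds hnot)
  have e2 := eventually_nhdsWithin_iff.1 hle
  have e3 := eventually_nhdsWithin_iff.1 ((D.cont_sub q hqK).eventually
    (gt_mem_nhds (show h q < φ q + ε / 2 by linarith [D.sub_le_bdry q hq])))
  have e4 := eventually_nhdsWithin_iff.1 ((D.cont_bdry q hq).eventually
    (gt_mem_nhds (show φ q < φ q + ε / 2 by linarith)))
  obtain ⟨r, hr, hball⟩ := Metric.nhds_basis_closedBall.eventually_iff.1
    (((e1.and e2).and e3).and e4)
  obtain ⟨C, hC, hCle⟩ := exists_pos_le_mul (show 0 < δ * r ^ 2 by positivity) (M - φ q)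
  have hcd : ContDiff ℝ 2 fun y => C * -β y := contDiff_const.mul hβ.neg
  have hψ : ContDiff ℝ 2 fun y => C * -β y + (φ q + ε / 2) := hcd.add contDiff_const
  have hneg : ∀ z ∈ K ∩ Metric.closedBall q r, 0 ≤ C * -β z := by
    intro z hz
    have h1 := (hball hz.2).1.1.2 hz.1
    have h2 : 0 ≤ δ * ‖z - q‖ ^ 2 := by positivity
    exact mul_nonneg hC.le (by linarith)
  have hcmp : ∀ u ∈ 𝓢, ∀ z ∈ K ∩ Metric.closedBall q r, u z ≤ C * -β z + (φ q + ε / 2) := by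
    intro u hu
    refine hu.2.1.le_of_isCompact (D.isCompact.inter_right Metric.isClosed_closedBall)
      (hu.1.mono Set.inter_subset_left) hψ.continuous.continuousOn fun z hz => ?_
    obtain ⟨⟨⟨h1, h2⟩, h3⟩, h4⟩ := hball hz.2
    have hnn := hneg z hz
    by_cases hzr : z ∈ Metric.ball q r
    · by_cases hzB : z ∈ B
      · left
        linarith [hu.2.2.2.2 z hzB, h4 hzB]
      by_cases hzY : z ∈ Y
      · right
        refine ⟨hzY, inter_mem (mem_of_superset (D.isOpen.mem_nhds hzY) D.subset)
          (mem_of_superset (Metric.isOpen_ball.mem_nhds hzr) Metric.ball_subset_closedBall),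
          hψ.contDiffAt, fun hmem => h1 ?_⟩
        rw [hessMatrix_add_const hcd.contDiffAt,
          hessMatrix_const_mul hβ.neg.contDiffAt, hessMatrix_neg] at hmem
        simpa [smul_smul, hC.ne'] using F.mats_smul hmem (inv_pos.2 hC)
      · left
        have := hu.2.2.2.1 z hz.1
        rw [D.super_eq z hz.1 hzY hzB] at this
        linarith [h3 hz.1]
    · left
      have hdist : ‖z - q‖ = r := by
        rw [← dist_eq_norm]
        exact le_antisymm hz.2 (not_lt.1 hzr)
      have h5 := h2 hz.1
      rw [hdist] at h5
      have h6 : C * (δ * r ^ 2) ≤ C * -β z := mul_le_mul_of_nonneg_left (by linarith) hC.le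
      linarith [hM u hu z hz.1]
  have hlt : C * -β q + (φ q + ε / 2) < φ q + ε := by
    rw [hβ0]
    linarith
  filter_upwards [self_mem_nhdsWithin, nhdsWithin_le_nhds (Metric.closedBall_mem_nhds q hr),
    nhdsWithin_le_nhds (hψ.continuous.continuousAt.eventually (gt_mem_nhds hlt))]
    with z hz1 hz2 hz3 u hu
  exact (hcmp u hu z ⟨hz1, hz2⟩).trans hz3.le

lemma sol_le_bdry (D : PerronData F K Y B h w φ) {q : EucSp n} (hq : q ∈ B) : 𝓗 q ≤ φ q :=
  le_of_forall_pos_le_add fun _ hε =>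
    upperEnvelope_le D.sub_mem (D.boundary_subset hq) (D.eventually_le_bdry hq hε)

lemma sol_mem (D : PerronData F K Y B h w φ) : 𝓗 ∈ 𝓢 := by
  obtain ⟨M, hM⟩ := D.exists_bound
  exact ⟨upperSemicontinuousOn_upperEnvelope D.sub_mem hM,
    viscSub_upperEnvelope D.isOpen D.subset D.sub_mem hM (fun u hu => hu.1) fun u hu => hu.2.1,
    fun y hy => D.le_sol D.sub_mem hy, fun y hy => D.sol_le_super hy, fun y hy => D.sol_le_bdry hy⟩

/-- A subsolution on an open set which lies below the Perron function near the boundary of that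
set, below the obstacle, and below the boundary values, lies below the Perron function. -/
lemma le_sol_of_glue (D : PerronData F K Y B h w φ)
    {U : Set (EucSp n)} (hU : IsOpen U) {v : EucSp n → ℝ}
    (husc : UpperSemicontinuousOn v (K ∩ U)) (hv : ViscSub F.carrier (Y ∩ U) v)
    (hvw : ∀ y ∈ K ∩ U, v y ≤ w y) (hvφ : ∀ y ∈ B ∩ U, v y ≤ φ y)
    (hglue : ∀ q ∈ K, q ∉ U → ∀ᶠ z in 𝓝[K] q, z ∈ U → v z ≤ 𝓗 z) :
    ∀ y ∈ K ∩ U, v y ≤ 𝓗 y := by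
  obtain ⟨h1, h2, h3, h4, h5⟩ := D.sol_mem
  set g : EucSp n → ℝ := fun y => if y ∈ U then max (𝓗 y) (v y) else 𝓗 y with hg
  have hHg : ∀ y, 𝓗 y ≤ g y := by
    intro y
    by_cases hy : y ∈ U <;> simp [hg, hy]
  have hgU : ∀ y ∈ U, g y = max (𝓗 y) (v y) := fun y hy => by simp [hg, hy]
  have hgU' : ∀ y, y ∉ U → g y = 𝓗 y := fun y hy => by simp [hg, hy]
  have hmem : g ∈ 𝓢 := by
    refine ⟨?_, ViscSub.of_touching fun p hp => ?_, fun y hy => (h3 y hy).trans (hHg y), ?_, ?_⟩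
    · rw [upperSemicontinuousOn_iff]
      intro q hq
      by_cases hqU : q ∈ U
      · have husc' := (h1.mono Set.inter_subset_left).sup husc
        have hnhds : 𝓝[K ∩ U] q = 𝓝[K] q := by
          rw [Set.inter_comm]
          exact nhdsWithin_inter_of_mem (nhdsWithin_le_nhds (hU.mem_nhds hqU))
        have h6 : UpperSemicontinuousWithinAt g (K ∩ U) q := by
          refine (husc'.upperSemicontinuousWithinAt ⟨hq, hqU⟩).congr_of_eventuallyEq ⟨hq, hqU⟩ ?_
          filter_upwards [self_mem_nhdsWithin] with z hz
          exact (hgU z hz.2).symm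
        rw [upperSemicontinuousWithinAt_iff] at h6 ⊢
        rwa [hnhds] at h6
      · refine (h1.upperSemicontinuousWithinAt hq).congr_of_eventuallyEq hq ?_
        filter_upwards [hglue q hq hqU] with z hz
        by_cases hzU : z ∈ U
        · rw [hgU z hzU, max_eq_left (hz hzU)]
        · rw [hgU' z hzU]
    · by_cases hgp : g p = 𝓗 p
      · exact ⟨𝓗, h2.mono (Set.singleton_subset_iff.2 hp), hgp.symm, Eventually.of_forall hHg⟩
      · have hpU : p ∈ U := by_contra fun hc => hgp (hgU' p hc)
        refine ⟨v, hv.mono (Set.singleton_subset_iff.2 ⟨hp, hpU⟩), ?_, ?_⟩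
        · rw [hgU p hpU] at hgp ⊢
          rcases max_choice (𝓗 p) (v p) with h | h
          · exact absurd h hgp
          · exact h.symm
        · filter_upwards [hU.mem_nhds hpU] with y hy
          rw [hgU y hy]
          exact le_max_right _ _
    · intro y hy
      by_cases hyU : y ∈ U
      · rw [hgU y hyU]
        exact max_le (h4 y hy) (hvw y ⟨hy, hyU⟩)
      · rw [hgU' y hyU]
        exact h4 y hy
    · intro y hy
      by_cases hyU : y ∈ U
      · rw [hgU y hyU]
        exact max_le (h5 y hy) (hvφ y ⟨hy, hyU⟩)
      · rw [hgU' y hyU]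
        exact h5 y hy
  intro y hy
  refine le_trans ?_ (D.le_sol hmem hy.1)
  rw [hgU y hy.2]
  exact le_max_right _ _

lemma eventually_bdry_le (D : PerronData F K Y B h w φ)
    {q : EucSp n} (hq : q ∈ B) {ε : ℝ} (hε : 0 < ε) :
    ∀ᶠ y in 𝓝[K] q, φ q - ε ≤ 𝓗 y := by
  obtain ⟨m, hm⟩ := (D.isCompact.image_of_continuousOn D.cont_sub).bddBelow
  obtain ⟨β, hβ, hβ0, hint, -, δ, hδ, hle⟩ := D.barrier q hq
  have hqK := D.boundary_subset hq
  have e1 : ∀ᶠ z in 𝓝 q, hessMatrix β z ∈ F.intMats :=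
    F.eventually_mem_intMats (continuousAt_hessMatrix hβ.contDiffAt)
      (Eventually.of_forall fun z => hessMatrix_isSymm hβ.contDiffAt) hint
  have e2 := eventually_nhdsWithin_iff.1 hle
  have e3 := eventually_nhdsWithin_iff.1 ((D.cont_super q hqK).eventually
    (lt_mem_nhds (show φ q - ε / 2 < w q by linarith [D.bdry_le q hq])))
  have e4 := eventually_nhdsWithin_iff.1 ((D.cont_bdry q hq).eventually
    (lt_mem_nhds (show φ q - ε / 2 < φ q by linarith)))
  obtain ⟨r, hr, hball⟩ := Metric.nhds_basis_ball.eventually_iff.1 (((e1.and e2).and e3).and e4)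
  obtain ⟨C, hC, hCle⟩ := exists_pos_le_mul (show 0 < δ * (r / 2) ^ 2 by positivity) (φ q - m)
  have hcd : ContDiff ℝ 2 fun y => C * β y := contDiff_const.mul hβ
  have hv : ContDiff ℝ 2 fun y => C * β y + (φ q - ε / 2) := hcd.add contDiff_const
  have hle' : ∀ z ∈ K ∩ Metric.ball q r, C * β z ≤ -(C * (δ * ‖z - q‖ ^ 2)) := by
    intro z hz
    have := mul_le_mul_of_nonneg_left ((hball hz.2).1.1.2 hz.1) hC.le
    linarith
  have hnonpos : ∀ z ∈ K ∩ Metric.ball q r, C * β z ≤ 0 := by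
    intro z hz
    have : 0 ≤ C * (δ * ‖z - q‖ ^ 2) := by positivity
    linarith [hle' z hz]
  have hglue := D.le_sol_of_glue Metric.isOpen_ball (U := Metric.ball q r)
    (v := fun y => C * β y + (φ q - ε / 2)) hv.continuous.continuousOn.upperSemicontinuousOn
    (viscSub_of_contDiffAt F (fun p _ => hv.contDiffAt) fun p hp => by
      rw [hessMatrix_add_const hcd.contDiffAt, hessMatrix_const_mul hβ.contDiffAt]
      exact F.mats_smul (F.intMats_subset (hball hp.2).1.1.1) hC)
    (fun y hy => by linarith [hnonpos y hy, (hball hy.2).1.2 hy.1])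
    (fun y hy => by linarith [hnonpos y ⟨D.boundary_subset hy.1, hy.2⟩, (hball hy.2).2 hy.1])
    (fun p hp hpU => by
      have hdist : r / 2 < dist p q := by
        rw [Metric.mem_ball, not_lt] at hpU
        linarith
      have hc : ContinuousAt (fun z => dist z q) p := by fun_prop
      filter_upwards [nhdsWithin_le_nhds (hc.eventually (lt_mem_nhds hdist)),
        self_mem_nhdsWithin] with z hz hzK hzU
      have h1 := hle' z ⟨hzK, hzU⟩
      have h2 : C * (δ * (r / 2) ^ 2) ≤ C * (δ * ‖z - q‖ ^ 2) := by
        rw [dist_eq_norm] at hz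
        gcongr
      have h3 : m ≤ h z := hm (Set.mem_image_of_mem _ hzK)
      linarith [D.le_sol D.sub_mem hzK])
  have hlt : φ q - ε < C * β q + (φ q - ε / 2) := by
    rw [hβ0]
    linarith
  filter_upwards [self_mem_nhdsWithin, nhdsWithin_le_nhds (Metric.ball_mem_nhds q hr),
    nhdsWithin_le_nhds (hv.continuous.continuousAt.eventually (lt_mem_nhds hlt))]
    with z hz1 hz2 hz3
  exact hz3.le.trans (hglue z ⟨hz1, hz2⟩)

lemma sol_eq_bdry (D : PerronData F K Y B h w φ) {q : EucSp n} (hq : q ∈ B) : 𝓗 q = φ q := by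
  refine le_antisymm (D.sol_le_bdry hq) (le_of_forall_pos_le_add fun ε hε => ?_)
  linarith [(D.eventually_bdry_le hq hε).self_of_nhdsWithin (D.boundary_subset hq)]

lemma continuousWithinAt_sol_bdry (D : PerronData F K Y B h w φ)
    {q : EucSp n} (hq : q ∈ B) : ContinuousWithinAt 𝓗 K q := by
  refine tendsto_order.2 ⟨fun a ha => ?_, fun a ha => ?_⟩
  · rw [D.sol_eq_bdry hq] at ha
    filter_upwards [D.eventually_bdry_le hq (half_pos (sub_pos.2 ha))] with y hy
    linarith
  · exact upperSemicontinuousWithinAt_iff.1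
      (D.sol_mem.1.upperSemicontinuousWithinAt (D.boundary_subset hq)) a ha

lemma sol_eq_sub (D : PerronData F K Y B h w φ)
    {q : EucSp n} (hq : q ∈ K) (hwq : w q = h q) : 𝓗 q = h q :=
  le_antisymm ((D.sol_le_super hq).trans_eq hwq) (D.le_sol D.sub_mem hq)

lemma continuousWithinAt_sol_of_notMem (D : PerronData F K Y B h w φ)
    {q : EucSp n} (hq : q ∈ K) (hqY : q ∉ Y) :
    ContinuousWithinAt 𝓗 K q := by
  by_cases hqB : q ∈ B
  · exact D.continuousWithinAt_sol_bdry hqB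
  have hwq := D.super_eq q hq hqY hqB
  have h1 : Tendsto h (𝓝[K] q) (𝓝 (h q)) := D.cont_sub q hq
  have h2 : Tendsto w (𝓝[K] q) (𝓝 (h q)) := hwq ▸ D.cont_super q hq
  rw [ContinuousWithinAt, D.sol_eq_sub hq hwq]
  refine tendsto_of_tendsto_of_tendsto_of_le_of_le' h1 h2 ?_ ?_
  · filter_upwards [self_mem_nhdsWithin] with y hy using D.le_sol D.sub_mem hy
  · filter_upwards [self_mem_nhdsWithin] with y hy using D.sol_le_super hy

lemma exists_dist_sol_lt (D : PerronData F K Y B h w φ) {η : ℝ} (hη : 0 < η) :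
    ∃ δ > 0, ∀ q ∈ K, q ∉ Y → ∀ z ∈ K, dist q z < δ → dist (𝓗 q) (𝓗 z) < η := by
  have : CompactSpace K := isCompact_iff_compactSpace.1 D.isCompact
  have hs : IsCompact {a : K | (a : EucSp n) ∉ Y} :=
    (D.isOpen.isClosed_compl.preimage continuous_subtype_val).isCompact
  have hf : ∀ a ∈ {a : K | (a : EucSp n) ∉ Y}, ContinuousAt (fun a : K => 𝓗 a) a := fun a ha =>
    (continuousWithinAt_iff_continuousAt_domRestrict 𝓗 a.2).1
      (D.continuousWithinAt_sol_of_notMem a.2 ha)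
  obtain ⟨δ, hδ, H⟩ := Metric.mem_uniformity_dist.1
    (hs.uniformContinuousAt_of_continuousAt _ hf (Metric.dist_mem_uniformity hη))
  exact ⟨δ, hδ, fun q hq hqY z hz hd => H (a := ⟨q, hq⟩) (b := ⟨z, hz⟩) hd hqY⟩

/-- Walsh's translation argument. -/
lemma exists_translate_le (D : PerronData F K Y B h w φ) {η : ℝ} (hη : 0 < η) :
    ∃ δ > 0, ∀ z ∈ Y, ∀ y : EucSp n, ‖y‖ < δ → z + y ∈ Y → 𝓗 (z + y) - η ≤ 𝓗 z := by
  obtain ⟨δ₁, hδ₁, H₁⟩ := D.exists_dist_sol_lt (half_pos hη)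
  obtain ⟨δ₂, hδ₂, H₂⟩ := Metric.uniformContinuousOn_iff.1
    (D.isCompact.uniformContinuousOn_of_continuous D.cont_super) η hη
  refine ⟨min δ₁ δ₂, lt_min hδ₁ hδ₂, fun z hz y hy hzy => ?_⟩
  have hcts : Continuous fun z : EucSp n => z + y := by fun_prop
  have hU : IsOpen (Y ∩ {z | z + y ∈ Y}) := D.isOpen.inter (D.isOpen.preimage hcts)
  refine D.le_sol_of_glue hU (v := fun z => 𝓗 (z + y) - η) ?_ ?_ ?_ ?_ ?_ z
    ⟨D.subset hz, hz, hzy⟩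
  · have h1 : UpperSemicontinuousOn (fun z => 𝓗 (z + y)) (K ∩ (Y ∩ {z | z + y ∈ Y})) :=
      D.sol_mem.1.comp hcts.continuousOn fun z hz => D.subset hz.2.2
    simpa only [sub_eq_add_neg] using h1.add upperSemicontinuousOn_const
  · exact (D.sol_mem.2.1.comp_add_sub y η).mono fun z hz => hz.2.2
  · intro z hz
    have h1 := D.sol_le_super (D.subset hz.2.2)
    have h2 := H₂ (z + y) (D.subset hz.2.2) z hz.1
      (by simpa using hy.trans_le (min_le_right _ _))
    rw [Real.dist_eq] at h2
    linarith [(abs_lt.1 h2).2]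
  · exact fun z hz => absurd hz.2.1 (D.notMem z hz.1)
  · intro q hqK hqU
    have hs : 0 < δ₁ - ‖y‖ := sub_pos.2 (hy.trans_le (min_le_left _ _))
    have hnear : ∀ᶠ z in 𝓝[K] q, dist q z < δ₁ - ‖y‖ := by
      filter_upwards [nhdsWithin_le_nhds (Metric.ball_mem_nhds q hs)] with z hz
      rwa [dist_comm]
    have key : ∀ p ∈ K, p ∉ Y → ∀ z ∈ Y, z + y ∈ Y → dist p z < δ₁ → dist p (z + y) < δ₁ →
        𝓗 (z + y) - η ≤ 𝓗 z := by
      intro p hpK hpY z hz hzy h1 h2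
      have h3 := H₁ p hpK hpY z (D.subset hz) h1
      have h4 := H₁ p hpK hpY (z + y) (D.subset hzy) h2
      rw [Real.dist_eq, abs_lt] at h3 h4
      linarith [h3.2, h4.1]
    by_cases hqY : q ∈ Y
    · have hqy : q + y ∉ Y := fun hc => hqU ⟨hqY, hc⟩
      by_cases hqyK : q + y ∈ K
      · filter_upwards [hnear] with z hz hzU
        refine key (q + y) hqyK hqy z hzU.1 hzU.2 ?_ ?_
        · have : dist (q + y) z ≤ dist (q + y) q + dist q z := dist_triangle _ _ _
          rw [dist_self_add_left] at this
          linarith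
        · rw [dist_add_right]
          linarith [norm_nonneg y]
      · have hopen : ∀ᶠ z in 𝓝 q, z + y ∉ K :=
          hcts.continuousAt.eventually (D.isCompact.isClosed.isOpen_compl.mem_nhds hqyK)
        filter_upwards [nhdsWithin_le_nhds hopen] with z hz hzU
        exact absurd (D.subset hzU.2) hz
    · filter_upwards [hnear] with z hz hzU
      refine key q hqK hqY z hzU.1 hzU.2 (by linarith [norm_nonneg y]) ?_
      have : dist q (z + y) ≤ dist q z + dist z (z + y) := dist_triangle _ _ _
      rw [dist_self_add_right] at this
      linarith

lemma continuousOn_sol (D : PerronData F K Y B h w φ) : ContinuousOn 𝓗 K := by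
  intro p hp
  by_cases hpY : p ∈ Y
  · refine tendsto_order.2 ⟨fun a ha => ?_, fun a ha => upperSemicontinuousWithinAt_iff.1
      (D.sol_mem.1.upperSemicontinuousWithinAt hp) a ha⟩
    obtain ⟨δ, hδ, H⟩ := D.exists_translate_le (half_pos (sub_pos.2 ha))
    filter_upwards [nhdsWithin_le_nhds (D.isOpen.mem_nhds hpY),
      nhdsWithin_le_nhds (Metric.ball_mem_nhds p hδ)] with z hz hzp
    have h1 := H z hz (p - z) (by rwa [← dist_eq_norm, dist_comm]) (by simpa using hpY)
    rw [add_sub_cancel] at h1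
    linarith
  · exact D.continuousWithinAt_sol_of_notMem hp hpY

lemma viscSub_dual_neg_sol (D : PerronData F K Y B h w φ)
    : ViscSub (dualSet F.carrier) Y (fun y => -𝓗 y) := by
  intro p hp ψ hψ hle heq
  by_contra hnot
  have hpK := D.subset hp
  have hlt : 𝓗 p < w p := by
    refine lt_of_le_of_ne (D.sol_le_super hpK) fun hw => hnot ?_
    refine D.visc_super p hp ψ hψ ?_ ((congrArg _ hw.symm).trans heq)
    filter_upwards [hle, D.isOpen.mem_nhds hp] with y hy hyY
    linarith [D.sol_le_super (D.subset hyY)]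
  have hint := F.neg_mem_intMats_of_notMem_dual (hessMatrix_isSymm hψ) hnot
  have hsd := contDiff_sqDist p
  obtain ⟨ε, hε, hεpos⟩ : ∃ ε : ℝ, -hessMatrix ψ p + -ε • (2 : ℝ) • 1 ∈ F.intMats ∧ 0 < ε := by
    have hc : Continuous fun ε : ℝ =>
        -hessMatrix ψ p + -ε • (2 : ℝ) • (1 : Matrix (Fin n) (Fin n) ℝ) := by fun_prop
    have ht : Tendsto (fun ε : ℝ =>
        -hessMatrix ψ p + -ε • (2 : ℝ) • (1 : Matrix (Fin n) (Fin n) ℝ)) (𝓝[>] 0)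
        (𝓝 (-hessMatrix ψ p)) := by
      simpa using (hc.tendsto 0).mono_left (nhdsWithin_le_nhds (s := Set.Ioi 0))
    exact ((F.eventually_mem_intMats ht (Eventually.of_forall fun ε =>
      (hessMatrix_isSymm hψ).neg.add ((Matrix.isSymm_one.smul (2 : ℝ)).smul (-ε))) hint).and
      self_mem_nhdsWithin).exists
  have hcd : ∀ᶠ y in 𝓝 p, ContDiffAt ℝ 2 ψ y := hψ.eventually (by simp)
  have hnear : ∀ᶠ y in 𝓝 p, -hessMatrix ψ y + -ε • (2 : ℝ) • 1 ∈ F.intMats :=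
    F.eventually_mem_intMats
      ((continuousAt_hessMatrix hψ).neg.add_const (-ε • (2 : ℝ) • 1))
      (hcd.mono fun y hy =>
        (hessMatrix_isSymm hy).neg.add ((Matrix.isSymm_one.smul (2 : ℝ)).smul (-ε))) hε
  set τ₀ := (w p - 𝓗 p) / 2 with hτ₀
  have hτ₀pos : 0 < τ₀ := by linarith
  have hww : ∀ᶠ y in 𝓝 p, -ψ y + τ₀ < w y := by
    have h1 : ContinuousAt (fun y => -ψ y + τ₀) p := hψ.continuousAt.neg.add continuousAt_const
    have h2 : ContinuousAt w p := (D.cont_super p hpK).continuousAt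
      (mem_of_superset (D.isOpen.mem_nhds hp) D.subset)
    refine h1.eventually_lt h2 ?_
    linarith
  obtain ⟨r, hr, hball⟩ := Metric.nhds_basis_ball.eventually_iff.1
    ((((hcd.and hnear).and hle).and hww).and (D.isOpen.mem_nhds hp))
  set τ := min τ₀ (ε * (r / 2) ^ 2) with hτ
  have hτpos : 0 < τ := lt_min hτ₀pos (by positivity)
  have hv : ∀ y ∈ Metric.ball p r,
      ContDiffAt ℝ 2 (fun y => (-ψ y + -ε * ‖y - p‖ ^ 2) + τ) y ∧
      hessMatrix (fun y => (-ψ y + -ε * ‖y - p‖ ^ 2) + τ) y ∈ F.mats := by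
    intro y hy
    obtain ⟨⟨⟨⟨h1, h2⟩, -⟩, -⟩, -⟩ := hball hy
    have h3 : ContDiffAt ℝ 2 (fun y => -ε * ‖y - p‖ ^ 2) y := (contDiff_const.mul hsd).contDiffAt
    refine ⟨(h1.neg.add h3).add contDiffAt_const, ?_⟩
    rw [hessMatrix_add_const (h1.neg.add h3), hessMatrix_add h1.neg h3, hessMatrix_neg,
      hessMatrix_const_mul hsd.contDiffAt, hessMatrix_sqDist]
    exact F.intMats_subset h2
  have hglue := D.le_sol_of_glue Metric.isOpen_ball (U := Metric.ball p r)
    (v := fun y => (-ψ y + -ε * ‖y - p‖ ^ 2) + τ)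
    (ContinuousOn.upperSemicontinuousOn fun y hy => (hv y hy.2).1.continuousAt.continuousWithinAt)
    (viscSub_of_contDiffAt F (fun y hy => (hv y hy.2).1) fun y hy => (hv y hy.2).2)
    (fun y hy => by
      have h1 : 0 ≤ ε * ‖y - p‖ ^ 2 := by positivity
      linarith [(hball hy.2).1.2, min_le_left τ₀ (ε * (r / 2) ^ 2)])
    (fun y hy => absurd (hball hy.2).2 (D.notMem y hy.1))
    (fun q hq hqU => by
      have hdist : r / 2 < dist q p := by
        rw [Metric.mem_ball, not_lt] at hqU
        linarith
      have hc : ContinuousAt (fun z => dist z p) q := by fun_prop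
      filter_upwards [nhdsWithin_le_nhds (hc.eventually (lt_mem_nhds hdist))] with z hz hzU
      have h1 : ε * (r / 2) ^ 2 ≤ ε * ‖z - p‖ ^ 2 := by
        rw [dist_eq_norm] at hz
        gcongr
      linarith [(hball hzU).1.1.2, min_le_right τ₀ (ε * (r / 2) ^ 2)])
    p ⟨hpK, Metric.mem_ball_self hr⟩
  simp only [sub_self, norm_zero] at hglue
  linarith

end PerronData

end Perron

section Obstacle

lemma eventually_forall_le_mul {Z : Set (EucSp n)} (hZ : IsCompact Z) {f g : EucSp n → ℝ}
    (hf : ContinuousOn f Z) (hg : ContinuousOn g Z) (hpos : ∀ y ∈ Z, 0 < g y) :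
    ∀ᶠ c : ℝ in atTop, ∀ y ∈ Z, f y ≤ c * g y := by
  obtain ⟨C, hC⟩ := (hZ.image_of_continuousOn
    (hf.div hg fun y hy => (hpos y hy).ne')).bddAbove
  filter_upwards [eventually_ge_atTop C] with c hc y hy
  exact (div_le_iff₀ (hpos y hy)).1 ((hC (Set.mem_image_of_mem _ hy)).trans hc)

/-- A function asymptotic to `g` at a strict minimum point of `g` is dominated by large
multiples of `g`. -/
lemma eventually_forall_sub_le_mul {K : Set (EucSp n)} (hK : IsCompact K)
    {h g : EucSp n → ℝ} (hh : ContinuousOn h K) (hg : ContinuousOn g K) {p : EucSp n}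
    (hmin : ∀ y ∈ K, y ≠ p → g p < g y)
    (hsim : Tendsto (fun y => (h y - h p) / (g y - g p)) (𝓝[≠] p) (𝓝 1)) :
    ∀ᶠ c : ℝ in atTop, ∀ y ∈ K, h y - h p ≤ c * (g y - g p) := by
  obtain ⟨r, hr, hball⟩ := Metric.nhds_basis_ball.eventually_iff.1
    (eventually_nhdsWithin_iff.1 (hsim.eventually (gt_mem_nhds one_lt_two)))
  have hfar := eventually_forall_le_mul (hK.diff (Metric.isOpen_ball (x := p) (ε := r)))
    ((hh.mono Set.sdiff_subset).sub (continuousOn_const (c := h p)))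
    ((hg.mono Set.sdiff_subset).sub (continuousOn_const (c := g p)))
    (fun y hy => sub_pos.2 (hmin y hy.1 fun hyp => hy.2 (hyp ▸ Metric.mem_ball_self hr)))
  filter_upwards [hfar, eventually_ge_atTop 2] with c hc hc2 y hy
  by_cases hyp : y = p
  · simp [hyp]
  have hpos : 0 < g y - g p := sub_pos.2 (hmin y hy hyp)
  by_cases hyr : y ∈ Metric.ball p r
  · exact (div_le_iff₀ hpos).1 ((hball hyr hyp).le.trans hc2)
  · exact hc y ⟨hy, hyr⟩

lemma StrictlyConvexBoundary.exists_barrier {F : ConeSubequation n} (hF3 : CondF3 F)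
    {Ω : Set (EucSp n)} (hΩ : IsOpen Ω) (h : StrictlyConvexBoundary F Ω) {q : EucSp n}
    (hq : q ∈ frontier Ω) :
    ∃ β : EucSp n → ℝ, ContDiff ℝ 2 β ∧ β q = 0 ∧ hessMatrix β q ∈ F.intMats ∧
      -hessMatrix β q ∉ F.mats ∧
      ∃ δ > 0, ∀ᶠ y in 𝓝[closure Ω] q, β y ≤ -δ * ‖y - q‖ ^ 2 := by
  obtain ⟨ρ, hρ, hΩρ, hbd⟩ := h
  have hcl : ∀ y ∈ closure Ω, ρ y ≤ 0 := fun y hy =>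
    closure_minimal (fun z hz => by rw [hΩρ] at hz; exact (show ρ z < 0 from hz).le)
      (isClosed_le hρ.continuous continuous_const) hy
  rw [hΩ.frontier_eq] at hq
  have hq0 : ρ q = 0 := by
    refine le_antisymm (hcl q hq.1) (not_lt.1 fun hlt => hq.2 ?_)
    rw [hΩρ]
    exact hlt
  rw [← hΩ.frontier_eq] at hq
  obtain ⟨hg, hconv⟩ := hbd q hq
  obtain ⟨β, h1, h2, h3, h4, δ, hδ, h5⟩ := exists_boundary_barrier F hF3
    (contDiff_infty.1 hρ 2) hq0 hg hconv
  refine ⟨β, h1, h2, h3, h4, δ, hδ, ?_⟩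
  filter_upwards [nhdsWithin_le_nhds h5, self_mem_nhdsWithin] with y hy hyK using hy (hcl y hyK)

/-- The minimum of the constant `M` and the functions `h (x j) + c (g j - g j (x j))`. -/
def minObstacle {k : ℕ} (x : Fin k → EucSp n) (h : EucSp n → ℝ) (g : Fin k → EucSp n → ℝ)
    (M c : ℝ) (y : EucSp n) : ℝ :=
  Finset.univ.inf' Finset.univ_nonempty fun o : Option (Fin k) =>
    o.elim M fun j => c * (g j y - g j (x j)) + h (x j)

variable {k : ℕ} {x : Fin k → EucSp n} {h : EucSp n → ℝ} {g : Fin k → EucSp n → ℝ} {M c : ℝ}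

lemma minObstacle_le (j : Fin k) (y : EucSp n) :
    minObstacle x h g M c y ≤ c * (g j y - g j (x j)) + h (x j) :=
  Finset.inf'_le (fun o : Option (Fin k) =>
    o.elim M fun j => c * (g j y - g j (x j)) + h (x j)) (Finset.mem_univ (some j))

lemma minObstacle_le_const (y : EucSp n) : minObstacle x h g M c y ≤ M :=
  Finset.inf'_le (fun o : Option (Fin k) =>
    o.elim M fun j => c * (g j y - g j (x j)) + h (x j)) (Finset.mem_univ none)

lemma le_minObstacle {a : ℝ} {y : EucSp n} (hM : a ≤ M)
    (hj : ∀ j, a ≤ c * (g j y - g j (x j)) + h (x j)) : a ≤ minObstacle x h g M c y := by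
  refine Finset.le_inf' _ _ fun o _ => ?_
  cases o with
  | none => exact hM
  | some j => exact hj j

lemma minObstacle_eq (y : EucSp n) : minObstacle x h g M c y = M ∨
    ∃ j, minObstacle x h g M c y = c * (g j y - g j (x j)) + h (x j) := by
  obtain ⟨o, -, ho⟩ := Finset.exists_mem_eq_inf' (Finset.univ_nonempty (α := Option (Fin k)))
    fun o : Option (Fin k) => o.elim M fun j => c * (g j y - g j (x j)) + h (x j)
  cases o with
  | none => exact Or.inl ho
  | some j => exact Or.inr ⟨j, ho⟩

lemma continuousOn_minObstacle {K : Set (EucSp n)} (hg : ∀ j, ContinuousOn (g j) K) :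
    ContinuousOn (minObstacle x h g M c) K := by
  refine ContinuousOn.finset_inf'_apply _ fun o _ => ?_
  cases o with
  | none => exact continuousOn_const
  | some j =>
    exact (continuousOn_const.mul ((hg j).sub continuousOn_const)).add continuousOn_const

lemma viscSub_dual_neg_minObstacle {F : ConeSubequation n} {Y : Set (EucSp n)} (hc : 0 < c)
    (hg : ∀ j, ViscSub (dualSet F.carrier) Y (fun y => -g j y)) :
    ViscSub (dualSet F.carrier) Y (fun y => -minObstacle x h g M c y) := by
  refine ViscSub.of_touching fun p hp => ?_
  rcases minObstacle_eq (x := x) (h := h) (g := g) (M := M) (c := c) p with hM | ⟨j, hj⟩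
  · exact ⟨fun _ => -M, viscSub_dual_const F _ _, by simp [hM],
      Eventually.of_forall fun y => neg_le_neg (minObstacle_le_const y)⟩
  · refine ⟨fun y => c * -g j y + (c * g j (x j) - h (x j)),
      ((hg j).mono (Set.singleton_subset_iff.2 hp)).dual_mul_add hc _, ?_,
      Eventually.of_forall fun y => ?_⟩
    · rw [hj]
      ring
    · linarith [minObstacle_le (x := x) (h := h) (g := g) (M := M) (c := c) j y]

end Obstacle

/-- Theorem 8.1, prescribing values at singularities in the finite case. -/
theorem dirichlet_singularities_stmt16 {n k : ℕ} (F : ConeSubequation n) (hF3 : CondF3 F)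
    (Ω : Set (EucSp n)) (hΩ : IsBoundedDomain Ω) (hbdry : StrictlyConvexBoundary F Ω)
    (φ : EucSp n → ℝ) (hφ : ContinuousOn φ (frontier Ω))
    (x : Fin k → EucSp n) (hx : ∀ j, x j ∈ Ω)
    (hj : Fin k → EucSp n → ℝ)
    (hjc : ∀ j, ContinuousOn (hj j) (closure Ω))
    (hjharm : ∀ j, FHarmonicOn F (Ω \ {x j}) (fun y => (hj j y : EReal)))
    (hjnotest : ∀ j, NoTestAt Ω (fun y => (hj j y : EReal)) (x j))
    -- (ii): each h_j has a strict global minimum at x_j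
    (hjmin : ∀ j, ∀ y ∈ closure Ω, y ≠ x j → hj j (x j) < hj j y)
    -- (iii): the global subsolution h
    (h : EucSp n → ℝ) (hhc : ContinuousOn h (closure Ω))
    (hhsub : FSubharmonicOn F.carrier (Ω \ Set.range x) (fun y => (h y : EReal)))
    (hsim : ∀ j, Filter.Tendsto
      (fun y => (h y - h (x j)) / (hj j y - hj j (x j))) (𝓝[≠] x j) (𝓝 1))
    (hhφ : ∀ y ∈ frontier Ω, h y ≤ φ y) :
    ∃ H : EucSp n → ℝ,
      ContinuousOn H (closure Ω) ∧
      FHarmonicOn F (Ω \ Set.range x) (fun y => (H y : EReal)) ∧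
      ((∀ y ∈ frontier Ω, H y = φ y) ∧ ∀ j, H (x j) = h (x j)) ∧
      ∃ c : ℝ, 1 < c ∧ ∀ ε : ℝ, 0 < ε → ∀ j, ∀ᶠ y in 𝓝[≠] x j,
        1 - ε ≤ (H y - h (x j)) / (hj j y - hj j (x j)) ∧
        (H y - h (x j)) / (hj j y - hj j (x j)) ≤ c := by
  obtain ⟨hΩo, -, hΩb⟩ := hΩ
  have hK : IsCompact (closure Ω) := hΩb.isCompact_closure
  have hB : IsCompact (frontier Ω) :=
    hK.of_isClosed_subset isClosed_frontier frontier_subset_closure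
  have hnotΩ : ∀ y ∈ frontier Ω, y ∉ Ω := fun y hy => (hΩo.frontier_eq ▸ hy).2
  have hYo : IsOpen (Ω \ Set.range x) := hΩo.sdiff (Set.finite_range x).isClosed
  have hsub : ∀ j, ∀ᶠ c : ℝ in atTop,
      ∀ y ∈ closure Ω, h y - h (x j) ≤ c * (hj j y - hj j (x j)) := fun j =>
    eventually_forall_sub_le_mul hK hhc (hjc j) (hjmin j) (hsim j)
  have hbd : ∀ j, ∀ᶠ c : ℝ in atTop,
      ∀ y ∈ frontier Ω, φ y - h (x j) ≤ c * (hj j y - hj j (x j)) := fun j =>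
    eventually_forall_le_mul hB (hφ.sub continuousOn_const)
      (((hjc j).mono frontier_subset_closure).sub continuousOn_const) fun y hy =>
        sub_pos.2 (hjmin j y (frontier_subset_closure hy) fun hyx => hnotΩ y hy (hyx ▸ hx j))
  obtain ⟨c, ⟨hc1, hc2⟩, hc⟩ := (((eventually_all.2 hsub).and (eventually_all.2 hbd)).and
    (eventually_gt_atTop (1 : ℝ))).exists
  obtain ⟨M₁, hM₁⟩ := (hK.image_of_continuousOn hhc).bddAbove
  obtain ⟨M₂, hM₂⟩ := (hB.image_of_continuousOn hφ).bddAbove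
  set w := minObstacle x h hj (max M₁ M₂) c with hw
  have hhw : ∀ y ∈ closure Ω, h y ≤ w y := fun y hy =>
    le_minObstacle ((hM₁ (Set.mem_image_of_mem _ hy)).trans (le_max_left _ _))
      fun j => by linarith [hc1 j y hy]
  have D : PerronData F (closure Ω) (Ω \ Set.range x) (frontier Ω) h w φ :=
    { isCompact := hK
      isOpen := hYo
      subset := Set.sdiff_subset.trans subset_closure
      boundary_subset := frontier_subset_closure
      notMem := fun y hy hyY => hnotΩ y hy hyY.1
      cont_sub := hhc
      visc_sub := hhsub.viscSub
      cont_super := continuousOn_minObstacle hjc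
      visc_super := by
        refine viscSub_dual_neg_minObstacle (zero_lt_one.trans hc) fun j => ?_
        have h1 := (hjharm j).2
        simp only [← EReal.coe_neg] at h1
        exact h1.viscSub.mono (Set.sdiff_subset_sdiff_right
          (Set.singleton_subset_iff.2 (Set.mem_range_self j)))
      cont_bdry := hφ
      sub_le := hhw
      sub_le_bdry := hhφ
      bdry_le := fun y hy =>
        le_minObstacle ((hM₂ (Set.mem_image_of_mem _ hy)).trans (le_max_right _ _))
          fun j => by linarith [hc2 j y hy]
      super_eq := by
        intro y hy hyY hyB
        have hyΩ : y ∈ Ω := by_contra fun hc => hyB (hΩo.frontier_eq ▸ ⟨hy, hc⟩)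
        obtain ⟨j, rfl⟩ : y ∈ Set.range x := by_contra fun hc => hyY ⟨hyΩ, hc⟩
        refine le_antisymm ?_ (hhw _ hy)
        simpa using minObstacle_le (x := x) (h := h) (g := hj) (M := max M₁ M₂) (c := c) j (x j)
      barrier := fun q hq => hbdry.exists_barrier hF3 hΩo hq }
  set H := perronSol F (closure Ω) (Ω \ Set.range x) (frontier Ω) h w φ with hH
  have hYK : Ω \ Set.range x ⊆ closure Ω := D.subset
  refine ⟨H, D.continuousOn_sol, ⟨?_, ?_⟩, ⟨fun y hy => D.sol_eq_bdry hy, fun j => ?_⟩,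
    c, hc, fun ε hε j => ?_⟩
  · exact D.sol_mem.2.1.fSubharmonicOn hYo (D.continuousOn_sol.mono hYK)
  · have h1 := D.viscSub_dual_neg_sol.fSubharmonicOn hYo (D.continuousOn_sol.mono hYK).neg
    simp only [EReal.coe_neg] at h1
    exact h1
  · have hxK := subset_closure (hx j)
    exact D.sol_eq_sub hxK (D.super_eq _ hxK (fun hc => hc.2 (Set.mem_range_self j))
      fun hc => hnotΩ _ hc (hx j))
  · filter_upwards [(hsim j).eventually (lt_mem_nhds (show 1 - ε < 1 by linarith)),
      nhdsWithin_le_nhds (hΩo.mem_nhds (hx j)), self_mem_nhdsWithin] with y hy hyΩ hyx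
    have hyK := subset_closure hyΩ
    have hpos : 0 < hj j y - hj j (x j) := sub_pos.2 (hjmin j y hyK hyx)
    constructor
    · refine hy.le.trans (div_le_div_of_nonneg_right ?_ hpos.le)
      linarith [D.le_sol D.sub_mem hyK]
    · rw [div_le_iff₀ hpos]
      linarith [D.sol_le_super hyK,
        minObstacle_le (x := x) (h := h) (g := hj) (M := max M₁ M₂) (c := c) j y]
end
end

section
/- Let F be a cone subequation on ℝⁿ that is invariant under O(n) (i.e., gᵀAg ∈ F for all g ∈ O(n) and A ∈ F) and has Riesz characteristic p with 1 < p < 2. Let Ω ⊂ ℝⁿ be a bounded domain and x₀ ∈ Ω. If H ∈ C(Ω̄) is F-harmonic on Ω ∖ {x₀} and satisfies H = 0 on ∂Ω, then H(x₀) ≤ 0. -/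
open scoped Topology Classical
open Filter

noncomputable section

variable {n : ℕ}

/-- Any symmetric matrix with entries of size at most `δ / n` becomes positive semidefinite after
adding `δ` times the identity. -/
lemma posSemidef_smul_one_add {n : ℕ} {δ : ℝ} {N : SymMat n}
    (hN : ∀ i j, n * |(N : Matrix (Fin n) (Fin n) ℝ) i j| ≤ δ) :
    (δ • (1 : Matrix (Fin n) (Fin n) ℝ) + N).PosSemidef := by
  have hs : (N : Matrix (Fin n) (Fin n) ℝ).IsHermitian := N.2
  have h1 : (δ • (1 : Matrix (Fin n) (Fin n) ℝ)).IsHermitian := by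
    simp [Matrix.IsHermitian]
  refine Matrix.PosSemidef.of_dotProduct_mulVec_nonneg (h1.add hs) fun x => ?_
  have hx : star x ⬝ᵥ ((δ • (1 : Matrix (Fin n) (Fin n) ℝ) + N).mulVec x)
      = δ * ∑ i, x i ^ 2
        + ∑ i, ∑ j, (N : Matrix (Fin n) (Fin n) ℝ) i j * (x i * x j) := by
    rw [Matrix.add_mulVec, dotProduct_add]
    congr 1
    · rw [Matrix.smul_mulVec, Matrix.one_mulVec, dotProduct_smul, smul_eq_mul]
      simp only [dotProduct, star_trivial, pow_two]
    · simp only [dotProduct, Matrix.mulVec, Finset.mul_sum, star_trivial]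
      refine Finset.sum_congr rfl fun i _ => Finset.sum_congr rfl fun j _ => ?_
      ring
  rw [hx]
  have hij : ∀ i j, -(δ / n * ((x i ^ 2 + x j ^ 2) / 2))
      ≤ (N : Matrix (Fin n) (Fin n) ℝ) i j * (x i * x j) := by
    intro i j
    have hn : (0 : ℝ) < n := by exact_mod_cast i.pos
    have hb : |(N : Matrix (Fin n) (Fin n) ℝ) i j| ≤ δ / n := by
      rw [le_div_iff₀ hn, mul_comm]; exact hN i j
    have hc : |x i * x j| ≤ (x i ^ 2 + x j ^ 2) / 2 := by
      rw [abs_le]; constructor <;> nlinarith [sq_nonneg (x i + x j), sq_nonneg (x i - x j)]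
    have := mul_le_mul hb hc (abs_nonneg _) ((abs_nonneg _).trans hb)
    rw [← abs_mul] at this
    exact (neg_le_neg this).trans (neg_abs_le _)
  have hsum := Finset.sum_le_sum fun i (_ : i ∈ Finset.univ) =>
    Finset.sum_le_sum fun j (_ : j ∈ Finset.univ) => hij i j
  have he : ∑ i, ∑ j, -(δ / n * ((x i ^ 2 + x j ^ 2) / 2)) = -(δ * ∑ i, x i ^ 2) := by
    rcases Nat.eq_zero_or_pos n with rfl | hn
    · simp
    · have hn' : (n : ℝ) ≠ 0 := by positivity
      simp only [Finset.sum_neg_distrib, ← Finset.mul_sum, ← Finset.sum_div,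
        Finset.sum_add_distrib, Finset.sum_const, Finset.card_univ, Fintype.card_fin,
        nsmul_eq_mul]
      field_simp
      ring
  linarith

/-- Adding a positive multiple of the identity to an element of a cone subequation gives an
interior point. -/
lemma ConeSubequation.add_smul_one_mem_interior {n : ℕ} (F : ConeSubequation n) {A C : SymMat n}
    (hA : A ∈ F.carrier) {δ : ℝ} (hδ : 0 < δ)
    (hC : (C : Matrix (Fin n) (Fin n) ℝ) = A + δ • (1 : Matrix (Fin n) (Fin n) ℝ)) :
    C ∈ interior F.carrier := by
  rw [mem_interior_iff_mem_nhds]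
  have hev : ∀ᶠ B : SymMat n in 𝓝 C, ∀ i j,
      n * |((B - C : SymMat n) : Matrix (Fin n) (Fin n) ℝ) i j| < δ := by
    refine eventually_all.2 fun i => eventually_all.2 fun j => ?_
    have hcont : Continuous fun B : SymMat n =>
        n * |((B - C : SymMat n) : Matrix (Fin n) (Fin n) ℝ) i j| := by
      refine continuous_const.mul (continuous_abs.comp ?_)
      exact (continuous_subtype_val.comp (continuous_id.sub continuous_const)).matrix_elem i j
    refine hcont.continuousAt.eventually_lt continuousAt_const ?_
    simpa using hδ
  filter_upwards [hev] with B hB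
  have hp := posSemidef_smul_one_add (N := B - C) (δ := δ) fun i j => (hB i j).le
  have hB' : ((B - A : SymMat n) : Matrix (Fin n) (Fin n) ℝ)
      = δ • (1 : Matrix (Fin n) (Fin n) ℝ) + ((B - C : SymMat n) : Matrix (Fin n) (Fin n) ℝ) := by
    simp only [AddSubgroup.coe_sub, hC]
    abel
  have := F.f1 A hA (B - A) (hB' ▸ hp)
  simpa using this

/-- The elements of a cone subequation of Riesz characteristic `p` satisfy, on matrices of the form
`P_{f⊥} - s P_f`, the constraint `s ≤ p - 1`. -/
lemma HasRieszChar.le_of_charMat_mem {n : ℕ} {F : ConeSubequation n} {p q : ℝ} (hp1 : 1 < p)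
    (hchar : HasRieszChar F p) {f : EucSp n} (hf : ‖f‖ = 1) (hq : charMat q f ∈ F.carrier) :
    q ≤ p := by
  by_contra! h
  have hq0 : 0 < q := by linarith
  have ht : 0 < p / q := by positivity
  refine (hchar f hf).2 (F.add_smul_one_mem_interior (F.f2 _ hq _ ht) (δ := 1 - p / q) ?_ ?_)
  · rw [sub_pos, div_lt_one hq0]; exact h
  · ext i j
    simp [charMat, charMatM]
    field_simp
    ring

lemma HasRieszChar.one_lt {n : ℕ} (hn : n ≠ 0) {F : ConeSubequation n} {p : ℝ} (hp1 : 1 < p)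
    (hchar : HasRieszChar F p) : 1 < n := by
  by_contra! h
  obtain rfl : n = 1 := by omega
  set e : EucSp 1 := EuclideanSpace.single 0 1
  have he : ‖e‖ = 1 := by simp [e]
  have hmem : charMat p e ∈ F.carrier := F.isClosed'.frontier_subset (hchar e he)
  refine (hchar e he).2 (F.add_smul_one_mem_interior (F.f2 _ hmem 2 two_pos) (δ := p - 1)
    (by linarith) ?_)
  ext i j
  rw [Subsingleton.elim i 0, Subsingleton.elim j 0]
  simp [charMat, charMatM, projMat, e]
  ring

/-- For two orthonormal vectors, `1 - P_e - P_f` is positive semidefinite. -/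
lemma posSemidef_one_sub_projMat_sub_projMat {n : ℕ} {e f : EucSp n} (he : ‖e‖ = 1) (hf : ‖f‖ = 1)
    (hef : inner ℝ e f = 0) : (1 - projMat e - projMat f).PosSemidef := by
  have hH : ∀ v : EucSp n, (projMat v).IsHermitian := fun v => projMat_selfAdjoint v
  refine Matrix.PosSemidef.of_dotProduct_mulVec_nonneg
    ((Matrix.isHermitian_one.sub (hH e)).sub (hH f)) fun x => ?_
  have hP : ∀ v : EucSp n, star x ⬝ᵥ (projMat v).mulVec x = inner ℝ v (WithLp.toLp 2 x) ^ 2 := by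
    intro v
    simp only [dotProduct, Matrix.mulVec, projMat, Matrix.of_apply, star_trivial,
      PiLp.inner_apply, RCLike.inner_apply, conj_trivial]
    rw [pow_two, Finset.sum_mul_sum]
    simp only [Finset.mul_sum]
    refine Finset.sum_congr rfl fun i _ => Finset.sum_congr rfl fun j _ => ?_
    ring
  have h1 : star x ⬝ᵥ (1 : Matrix (Fin n) (Fin n) ℝ).mulVec x = ‖WithLp.toLp 2 x‖ ^ 2 := by
    rw [EuclideanSpace.norm_sq_eq]
    simp [dotProduct, pow_two]
  rw [Matrix.sub_mulVec, Matrix.sub_mulVec, dotProduct_sub, dotProduct_sub, hP, hP, h1]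
  have ho : Orthonormal ℝ ![e, f] := by
    simp [orthonormal_vecCons_iff, he, hf, hef]
  have := ho.sum_inner_products_le (x := WithLp.toLp 2 x) (s := Finset.univ)
  simp [Fin.sum_univ_two] at this
  linarith

/-- The matrix `P_e - P_{e⊥}` is not in a cone subequation of Riesz characteristic `1 < p < 2`. -/
lemma HasRieszChar.notMem_of_coe_eq {n : ℕ} (hn : n ≠ 0) {F : ConeSubequation n} {p : ℝ}
    (hp1 : 1 < p) (hp2 : p < 2) (hchar : HasRieszChar F p) {e : EucSp n} (he : ‖e‖ = 1)
    {A : SymMat n} (hA : (A : Matrix (Fin n) (Fin n) ℝ) = (2 : ℝ) • projMat e - 1) :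
    A ∉ F.carrier := by
  intro hAF
  have hn1 := hchar.one_lt hn hp1
  obtain ⟨f, hf, hef⟩ : ∃ f : EucSp n, ‖f‖ = 1 ∧ inner ℝ e f = 0 := by
    have hrank : 1 < Module.finrank ℝ (EucSp n) := by simpa using hn1
    have hlt : Module.finrank ℝ (ℝ ∙ e) < Module.finrank ℝ (EucSp n) :=
      (finrank_span_singleton (K := ℝ) (v := e) (by rintro rfl; simp at he)).trans_lt hrank
    have hne : (ℝ ∙ e)ᗮ ≠ ⊥ := by
      intro h
      have := Submodule.finrank_add_finrank_orthogonal (ℝ ∙ e)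
      rw [h, finrank_bot] at this
      omega
    obtain ⟨v, hv, hv0⟩ := Submodule.exists_mem_ne_zero_of_ne_bot hne
    refine ⟨‖v‖⁻¹ • v, norm_smul_inv_norm hv0, ?_⟩
    rw [inner_smul_right, Submodule.mem_orthogonal_singleton_iff_inner_right.1 hv, mul_zero]
  have hsub : ((charMat 2 f - A : SymMat n) : Matrix (Fin n) (Fin n) ℝ)
      = (2 : ℝ) • (1 - projMat e - projMat f) := by
    ext i j
    simp [charMat, charMatM, hA]
    ring
  have hp : ((charMat 2 f - A : SymMat n) : Matrix (Fin n) (Fin n) ℝ).PosSemidef :=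
    hsub ▸ (posSemidef_one_sub_projMat_sub_projMat he hf hef).smul zero_le_two
  have hmem : charMat 2 f ∈ F.carrier := by simpa using F.f1 A hAF _ hp
  linarith [hchar.le_of_charMat_mem hp1 hf hmem]

/-- The Hessian of `k - ε log |x - x₀|²`. -/
lemma hessMatrix_const_sub_mul_log {n : ℕ} {x₀ y : EucSp n} (hy : y ≠ x₀) (k ε : ℝ) :
    hessMatrix (fun z => k - ε * Real.log (‖z - x₀‖ ^ 2)) y
      = (2 * ε / ‖y - x₀‖ ^ 2) •
        ((2 : ℝ) • projMat (‖y - x₀‖⁻¹ • (y - x₀)) - 1) := by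
  have hd : ∀ z : EucSp n, HasFDerivAt (fun z : EucSp n => ‖z - x₀‖ ^ 2)
      (2 • innerSL ℝ (z - x₀)) z := by
    intro z
    simpa using ((hasFDerivAt_id z).sub_const x₀).norm_sq
  have hne : ∀ z : EucSp n, z ≠ x₀ → ‖z - x₀‖ ^ 2 ≠ 0 := fun z hz => by
    simpa [sub_eq_zero] using hz
  have hf : ∀ z : EucSp n, z ≠ x₀ → ∀ v,
      fderiv ℝ (fun z => k - ε * Real.log (‖z - x₀‖ ^ 2)) z v
        = -(2 * ε) * (inner ℝ (z - x₀) v * (‖z - x₀‖ ^ 2)⁻¹) := by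
    intro z hz v
    rw [((((hd z).log (hne z hz)).const_mul ε).const_sub k).fderiv]
    simp [inner_sub_left]
    ring
  have hC : ContDiffAt ℝ 2 (fun z => k - ε * Real.log (‖z - x₀‖ ^ 2)) y := by
    refine contDiffAt_const.sub (contDiffAt_const.mul (ContDiffAt.log ?_ (hne y hy)))
    exact (contDiffAt_id.sub contDiffAt_const).norm_sq ℝ
  have hdd : DifferentiableAt ℝ (fderiv ℝ (fun z => k - ε * Real.log (‖z - x₀‖ ^ 2))) y :=
    (hC.fderiv_right (m := 1) (by norm_num)).differentiableAt one_ne_zero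
  have hr : ‖y - x₀‖ ≠ 0 := by simpa [sub_eq_zero] using hy
  ext i j
  set u : EucSp n := EuclideanSpace.single i 1
  set v : EucSp n := EuclideanSpace.single j 1
  have h2 : fderiv ℝ (fderiv ℝ (fun z => k - ε * Real.log (‖z - x₀‖ ^ 2))) y u v
      = fderiv ℝ (fun z => fderiv ℝ (fun z => k - ε * Real.log (‖z - x₀‖ ^ 2)) z v) y u := by
    rw [fderiv_clm_apply hdd (differentiableAt_const v)]
    simp
  have h3 : (fun z => fderiv ℝ (fun z => k - ε * Real.log (‖z - x₀‖ ^ 2)) z v) =ᶠ[𝓝 y]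
      fun z => -(2 * ε) * (inner ℝ (z - x₀) v * (‖z - x₀‖ ^ 2)⁻¹) := by
    filter_upwards [isOpen_ne.mem_nhds hy] with z hz using hf z hz v
  have hi : HasFDerivAt (fun z : EucSp n => inner ℝ (z - x₀) v) (innerSL ℝ v) y := by
    simp_rw [real_inner_comm]
    exact (innerSL ℝ v).hasFDerivAt.comp y ((hasFDerivAt_id y).sub_const x₀)
  have h4 := (hi.mul ((hasDerivAt_inv (hne y hy)).comp_hasFDerivAt y (hd y))).const_mul (-(2 * ε))
  rw [hessMatrix, Matrix.of_apply, iteratedFDeriv_two_apply]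
  simp only [Matrix.cons_val_zero, Matrix.cons_val_one]
  rw [h2, h3.fderiv_eq,
    show fderiv ℝ (fun z => -(2 * ε) * (inner ℝ (z - x₀) v * (‖z - x₀‖ ^ 2)⁻¹)) y = _
      from h4.fderiv]
  have hin : ∀ (w : EucSp n) l, inner ℝ w (EuclideanSpace.single l (1 : ℝ)) = w l := fun w l => by
    simp [EuclideanSpace.inner_single_right]
  have hvu : inner ℝ v u = (1 : Matrix (Fin n) (Fin n) ℝ) i j := by
    simp [u, v, hin, Matrix.one_apply]
  have hu : inner ℝ (y - x₀) u = (y - x₀) i := hin _ i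
  have hv : inner ℝ (y - x₀) v = (y - x₀) j := hin _ j
  simp only [projMat, Function.comp_apply, smul_apply, add_apply,
    innerSL_apply_apply, smul_eq_mul, hvu, hu, hv, Matrix.smul_apply, Matrix.sub_apply,
    Matrix.of_apply, PiLp.smul_apply]
  field_simp
  ring

/-- Proposition 8.5: for an O(n)-invariant cone subequation of Riesz
characteristic 1 < p < 2, any H ∈ C(Ω̄) which is F-harmonic on Ω∖{x₀} and vanishes on ∂Ω
satisfies H(x₀) ≤ 0. -/
theorem dirichlet_singularities_stmt17 {n : ℕ} (F : ConeSubequation n)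
    (hinv : OrthInvariant F)
    (p : ℝ) (hp1 : 1 < p) (hp2 : p < 2) (hchar : HasRieszChar F p)
    (Ω : Set (EucSp n)) (hΩ : IsBoundedDomain Ω) (x₀ : EucSp n) (hx₀ : x₀ ∈ Ω)
    (H : EucSp n → ℝ) (hHc : ContinuousOn H (closure Ω))
    (hHharm : FHarmonicOn F (Ω \ {x₀}) (fun y => (H y : EReal)))
    (hHbd : ∀ y ∈ frontier Ω, H y = 0) :
    H x₀ ≤ 0 := by
  obtain ⟨hopen, -, hbdd⟩ := hΩ
  have hn : n ≠ 0 := by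
    rintro rfl
    refine F.proper' (Set.eq_univ_of_forall fun A => ?_)
    obtain ⟨B, hB⟩ := F.nonempty'
    rwa [Subsingleton.elim A B]
  have : NeZero n := ⟨hn⟩
  by_contra! hpos
  have hcomp : IsCompact (closure Ω) := hbdd.isCompact_closure
  obtain ⟨z₁, hz₁pos, hz₁Ω, hz₁⟩ : ∃ z, 0 < H z ∧ z ∈ Ω ∧ z ≠ x₀ := by
    have h1 : ∀ᶠ z in 𝓝[≠] x₀, 0 < H z ∧ z ∈ Ω := nhdsWithin_le_nhds <|
      ((hHc.continuousAt (mem_of_superset (hopen.mem_nhds hx₀) subset_closure)).eventually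
        (lt_mem_nhds hpos)).and (hopen.mem_nhds hx₀)
    obtain ⟨z, ⟨ha, hb⟩, hc⟩ := (h1.and self_mem_nhdsWithin).exists
    exact ⟨z, ha, hb, hc⟩
  obtain ⟨R, hR0, hR⟩ := hcomp.isBounded.subset_closedBall_lt 0 x₀
  obtain ⟨M, hM⟩ := hcomp.bddAbove_image hHc
  have hnorm : ∀ z, z ≠ x₀ → 0 < ‖z - x₀‖ ^ 2 := fun z hz => by
    have := norm_pos_iff.2 (sub_ne_zero.2 hz)
    positivity
  set c := Real.log (R ^ 2)
  have hc : ∀ z ∈ closure Ω, z ≠ x₀ → Real.log (‖z - x₀‖ ^ 2) ≤ c := fun z hz hzx => by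
    have : ‖z - x₀‖ ≤ R := by simpa [dist_eq_norm] using hR hz
    exact Real.log_le_log (hnorm z hzx) (by gcongr)
  obtain ⟨ε, hε, hεz⟩ : ∃ ε > 0, ε * (c - Real.log (‖z₁ - x₀‖ ^ 2)) < H z₁ := by
    have hle := sub_nonneg.2 (hc z₁ (subset_closure hz₁Ω) hz₁)
    refine ⟨H z₁ / (c - Real.log (‖z₁ - x₀‖ ^ 2) + 1), by positivity, ?_⟩
    rw [div_mul_eq_mul_div, div_lt_iff₀ (by positivity)]
    nlinarith
  set g : EucSp n → ℝ := fun z => H z + ε * (Real.log (‖z - x₀‖ ^ 2) - c) with hg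
  have hgz₁ : 0 < g z₁ := by simp only [hg]; linarith
  set ρ := Real.exp (c - M / ε)
  have hρ : ∀ z ∈ closure Ω, z ≠ x₀ → ‖z - x₀‖ ^ 2 < ρ → g z ≤ 0 := by
    intro z hz hzx hlt
    have h1 := (Real.log_lt_iff_lt_exp (hnorm z hzx)).2 hlt
    have h2 : H z ≤ M := hM (Set.mem_image_of_mem H hz)
    have h3 : ε * (Real.log (‖z - x₀‖ ^ 2) - c) ≤ ε * (-(M / ε)) := by
      gcongr; linarith
    rw [mul_neg, mul_div_cancel₀ _ hε.ne'] at h3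
    simp only [hg]; linarith
  set K := closure Ω ∩ {z | ρ ≤ ‖z - x₀‖ ^ 2}
  have hK : IsCompact K := hcomp.inter_right (isClosed_le continuous_const (by fun_prop))
  have hKne : ∀ z ∈ K, z ≠ x₀ := by
    rintro z ⟨-, hz⟩ rfl
    have hp : 0 < ρ := Real.exp_pos _
    simp at hz
    linarith
  have hz₁K : z₁ ∈ K := by
    refine ⟨subset_closure hz₁Ω, ?_⟩
    by_contra! h
    simp only [Set.mem_ofPred_eq, not_le] at h
    exact (hρ z₁ (subset_closure hz₁Ω) hz₁ h).not_gt hgz₁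
  have hgc : ContinuousOn g K := by
    refine (hHc.mono Set.inter_subset_left).add (continuousOn_const.mul (ContinuousOn.sub ?_
      continuousOn_const))
    exact ContinuousOn.log (by fun_prop) fun z hz => (hnorm z (hKne z hz)).ne'
  obtain ⟨y, hyK, hymax⟩ := hK.exists_isMaxOn ⟨z₁, hz₁K⟩ hgc
  have hyx := hKne y hyK
  have hgy : 0 < g y := hgz₁.trans_le (hymax hz₁K)
  have hyΩ : y ∈ Ω := by
    by_contra hy
    have hfr : y ∈ frontier Ω := ⟨hyK.1, by rwa [hopen.interior_eq]⟩
    have h1 := hc y hyK.1 hyx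
    simp only [hg, hHbd y hfr] at hgy
    nlinarith
  have htest : IsTestAt (Ω \ {x₀}) (fun y => (H y : EReal))
      (fun z => (H y + ε * Real.log (‖y - x₀‖ ^ 2)) - ε * Real.log (‖z - x₀‖ ^ 2)) y := by
    refine ⟨?_, ?_, by simp⟩
    · refine contDiffAt_const.sub (contDiffAt_const.mul (ContDiffAt.log ?_ (hnorm y hyx).ne'))
      exact (contDiffAt_id.sub contDiffAt_const).norm_sq ℝ
    · filter_upwards [self_mem_nhdsWithin] with z hz
      rw [EReal.coe_le_coe_iff]
      have hgzy : g z ≤ g y := by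
        by_cases hzK : ρ ≤ ‖z - x₀‖ ^ 2
        · exact hymax ⟨subset_closure hz.1, hzK⟩
        · exact (hρ z (subset_closure hz.1) hz.2 (not_le.1 hzK)).trans hgy.le
      simp only [hg] at hgzy
      linarith
  obtain ⟨A, hAF, hA⟩ := hHharm.1.2.2 y ⟨hyΩ, hyx⟩ _ htest
  rw [hessMatrix_const_sub_mul_log hyx] at hA
  have hs : 0 < 2 * ε / ‖y - x₀‖ ^ 2 := div_pos (by positivity) (hnorm y hyx)
  refine hchar.notMem_of_coe_eq hn hp1 hp2
    (norm_smul_inv_norm (𝕜 := ℝ) (sub_ne_zero.2 hyx)) ?_ (F.f2 A hAF _ (inv_pos.2 hs))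
  rw [selfAdjoint.val_smul, hA, smul_smul, inv_mul_cancel₀ hs.ne', one_smul]
  rfl
end
end
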